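/- arXiv:2006.16995 — 8 statements merged into one kernel-verified Lean document; each statement's English description precedes it below -/
import Mathlib

section
/- In the universal (free) Coxeter system on an index type B with decidable equality, a word L : List B is reduced (that is, ℓ(π(L)) equals the length of L) if and only if L is destuttered (L.destutter = L). -/
/-- The universal (free) Coxeter matrix on an index type `B`: its diagonal entries are `1`
and its off-diagonal entries are `0` (encoding order `∞`). -/
def universalCoxeterMatrix (B : Type*) [DecidableEq B] : CoxeterMatrix B where
  M := Matrix.of fun b b' => if b = b' then 1 else 0
  isSymm := by
    ext b b'
    by_cases h : b = b' <;> simp [Matrix.transpose_apply, h, eq_comm]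
  diagonal := fun b => by simp
  off_diagonal := fun b b' h => by simp [h]

namespace List

variable {B : Type*} [DecidableEq B]

/-- Prepend a letter to a word, cancelling it against the head if they agree. -/
def cancelCons (b : B) : List B → List B
  | [] => [b]
  | a :: l => if b = a then l else b :: a :: l

theorem length_cancelCons_le (b : B) (l : List B) :
    (l.cancelCons b).length ≤ l.length + 1 := by
  cases l with
  | nil => simp [cancelCons]
  | cons a l => rw [cancelCons]; split_ifs <;> simp; omega

theorem IsChain.cancelCons {l : List B} (hl : l.IsChain (· ≠ ·)) (b : B) :
    (l.cancelCons b).IsChain (· ≠ ·) := by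
  cases l with
  | nil => simp [List.cancelCons]
  | cons a l =>
    rw [List.cancelCons]
    split_ifs with h
    · exact hl.tail
    · exact isChain_cons_cons.2 ⟨h, hl⟩

theorem IsChain.cancelCons_eq_cons {b : B} {l : List B} (h : (b :: l).IsChain (· ≠ ·)) :
    l.cancelCons b = b :: l := by
  cases l with
  | nil => rfl
  | cons a l => exact if_neg (isChain_cons_cons.1 h).1

theorem IsChain.cancelCons_cancelCons {l : List B} (hl : l.IsChain (· ≠ ·)) (b : B) :
    (l.cancelCons b).cancelCons b = l := by
  cases l with
  | nil => simp [List.cancelCons]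
  | cons a l =>
    by_cases h : b = a
    · subst h
      rw [List.cancelCons, if_pos rfl, hl.cancelCons_eq_cons]
    · simp [List.cancelCons, h]

end List

namespace CoxeterSystem

variable {B W : Type*} [Group W]

theorem IsReduced.isChain_ne {M : CoxeterMatrix B} {cs : CoxeterSystem M W} {L : List B}
    (hL : cs.IsReduced L) : L.IsChain (· ≠ ·) := by
  induction L with
  | nil => simp
  | cons a l ih =>
    have hl := ih (hL.drop 1)
    cases l with
    | nil => simp
    | cons b l =>
      refine List.isChain_cons_cons.2 ⟨?_, hl⟩
      rintro rfl
      have h := hL.eq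
      rw [wordProd_cons, wordProd_cons, simple_mul_simple_cancel_left] at h
      have hle := cs.length_wordProd_le l
      simp only [List.length_cons] at h
      omega

variable [DecidableEq B]

/-- The action of the universal Coxeter group on words without equal adjacent letters, in which
a simple reflection acts by prepending its letter with cancellation. -/
def universalAction (cs : CoxeterSystem (universalCoxeterMatrix B) W) :
    W →* Function.End {l : List B // l.IsChain (· ≠ ·)} :=
  cs.lift ⟨fun b l => ⟨l.1.cancelCons b, l.2.cancelCons b⟩, by
    intro i j
    by_cases h : i = j
    · subst h
      rw [CoxeterMatrix.diagonal, pow_one]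
      funext l
      exact Subtype.ext (l.2.cancelCons_cancelCons i)
    · have hM : universalCoxeterMatrix B i j = 0 := if_neg h
      rw [hM, pow_zero]⟩

theorem universalAction_simple (cs : CoxeterSystem (universalCoxeterMatrix B) W) (b : B) :
    cs.universalAction (cs.simple b) = fun l => ⟨l.1.cancelCons b, l.2.cancelCons b⟩ :=
  cs.lift_apply_simple _ b

theorem universalAction_wordProd_nil (cs : CoxeterSystem (universalCoxeterMatrix B) W)
    (L : List B) :
    (cs.universalAction (cs.wordProd L) ⟨[], List.isChain_nil⟩).1 =
      L.foldr List.cancelCons [] := by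
  induction L with
  | nil => simp [Function.End.one_def]
  | cons a l ih =>
    rw [wordProd_cons, map_mul, List.foldr_cons, ← ih]
    exact congrArg Subtype.val (congrFun (cs.universalAction_simple a) _)

end CoxeterSystem

namespace List

variable {B : Type*} [DecidableEq B]

theorem length_foldr_cancelCons_le (L : List B) :
    (L.foldr cancelCons []).length ≤ L.length := by
  induction L with
  | nil => simp
  | cons a l ih =>
    exact (length_cancelCons_le _ _).trans (Nat.succ_le_succ ih)

theorem IsChain.foldr_cancelCons {L : List B} (hL : L.IsChain (· ≠ ·)) :
    L.foldr List.cancelCons [] = L := by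
  induction L with
  | nil => rfl
  | cons a l ih => rw [foldr_cons, ih hL.tail, hL.cancelCons_eq_cons]

end List

/-- In the universal (free) Coxeter system on `B`, a word `L` is reduced (the Coxeter
length of its product equals its length) if and only if it is destuttered. -/
theorem universal_isReduced_iff_destuttered {B W : Type*} [DecidableEq B] [Group W]
    (cs : CoxeterSystem (universalCoxeterMatrix B) W) (L : List B) :
    cs.length (cs.wordProd L) = L.length ↔ L.destutter (· ≠ ·) = L := by
  rw [List.destutter_eq_self_iff]
  refine ⟨fun h => CoxeterSystem.IsReduced.isChain_ne (cs := cs) h, fun h => ?_⟩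
  refine (cs.length_wordProd_le L).antisymm ?_
  obtain ⟨ω, hω, hLω⟩ := cs.exists_isReduced (cs.wordProd L)
  have heq : L = ω.foldr List.cancelCons [] := by
    rw [← cs.universalAction_wordProd_nil, ← hLω, cs.universalAction_wordProd_nil,
      h.foldr_cancelCons]
  rw [hLω, hω.eq]
  exact (congrArg List.length heq).trans_le ω.length_foldr_cancelCons_le
end

section
/- In the universal (free) Coxeter system on an index type B with decidable equality, if L and L′ are destuttered words with π(L) = π(L′), then L = L′; that is, the elements of the universal Coxeter group are in bijection with destuttered words via the product map. -/
/-- Left multiplication by the letter `b` on words: delete a leading `b` if there is one,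
and prepend `b` otherwise. -/
def List.toggleHead {B : Type*} [DecidableEq B] (b : B) : List B → List B
  | [] => [b]
  | a :: l => if b = a then l else b :: a :: l

theorem List.toggleHead_of_isChain_cons {B : Type*} [DecidableEq B] {b : B} {L : List B}
    (h : (b :: L).IsChain (· ≠ ·)) : L.toggleHead b = b :: L := by
  cases L with
  | nil => rfl
  | cons a l => simp [toggleHead, (List.isChain_cons_cons.mp h).1]

theorem List.IsChain.toggleHead {B : Type*} [DecidableEq B] (b : B) {L : List B}
    (h : L.IsChain (· ≠ ·)) : (L.toggleHead b).IsChain (· ≠ ·) := by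
  cases L with
  | nil => simp [List.toggleHead]
  | cons a l =>
    by_cases hab : b = a
    · simpa [List.toggleHead, hab] using h.tail
    · simpa [List.toggleHead, hab] using h

theorem List.IsChain.toggleHead_toggleHead {B : Type*} [DecidableEq B] (b : B) {L : List B}
    (h : L.IsChain (· ≠ ·)) : (L.toggleHead b).toggleHead b = L := by
  cases L with
  | nil => simp [List.toggleHead]
  | cons a l =>
    by_cases hab : b = a
    · subst hab
      rw [show (b :: l).toggleHead b = l by simp [List.toggleHead],
        List.toggleHead_of_isChain_cons h]
    · simp [List.toggleHead, hab]

/-- The map `List.toggleHead b` as an endofunction of the set of destuttered words. -/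
def destutteredToggle {B : Type*} [DecidableEq B] (b : B) :
    Function.End {L : List B // L.IsChain (· ≠ ·)} :=
  fun L => ⟨L.1.toggleHead b, L.2.toggleHead b⟩

theorem isLiftable_destutteredToggle {B : Type*} [DecidableEq B] :
    (universalCoxeterMatrix B).IsLiftable (destutteredToggle (B := B)) := by
  intro b b'
  by_cases h : b = b'
  · subst h
    rw [(universalCoxeterMatrix B).diagonal, pow_one]
    funext L
    exact Subtype.ext (L.2.toggleHead_toggleHead b)
  · have hM : universalCoxeterMatrix B b b' = 0 := if_neg h
    rw [hM, pow_zero]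

namespace CoxeterSystem

variable {B W : Type*} [DecidableEq B] [Group W]

theorem wordProd_toggleHead {M : CoxeterMatrix B} (cs : CoxeterSystem M W) (b : B) (L : List B) :
    cs.wordProd (L.toggleHead b) = cs.simple b * cs.wordProd L := by
  cases L with
  | nil => simp [List.toggleHead]
  | cons a l =>
    by_cases h : b = a
    · simp [List.toggleHead, h, wordProd_cons]
    · simp [List.toggleHead, h, wordProd_cons]

/-- The destuttered word representing an element of the universal Coxeter group. -/
def destutteredWord (cs : CoxeterSystem (universalCoxeterMatrix B) W) (w : W) :
    {L : List B // L.IsChain (· ≠ ·)} :=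
  cs.lift ⟨destutteredToggle, isLiftable_destutteredToggle⟩ w ⟨[], .nil⟩

theorem destutteredWord_one (cs : CoxeterSystem (universalCoxeterMatrix B) W) :
    (cs.destutteredWord 1).1 = [] := by
  rw [destutteredWord, map_one]
  rfl

theorem destutteredWord_simple_mul (cs : CoxeterSystem (universalCoxeterMatrix B) W)
    (b : B) (w : W) :
    (cs.destutteredWord (cs.simple b * w)).1 = (cs.destutteredWord w).1.toggleHead b := by
  rw [destutteredWord, map_mul, lift_apply_simple]
  rfl

theorem destutteredWord_wordProd (cs : CoxeterSystem (universalCoxeterMatrix B) W)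
    {L : List B} (h : L.IsChain (· ≠ ·)) : (cs.destutteredWord (cs.wordProd L)).1 = L := by
  induction L with
  | nil => rw [wordProd_nil, destutteredWord_one]
  | cons b l ih =>
    rw [wordProd_cons, destutteredWord_simple_mul, ih h.tail, List.toggleHead_of_isChain_cons h]

theorem wordProd_destutteredWord (cs : CoxeterSystem (universalCoxeterMatrix B) W) (w : W) :
    cs.wordProd (cs.destutteredWord w).1 = w := by
  induction w using cs.simple_induction_left with
  | one => rw [destutteredWord_one, wordProd_nil]
  | mul_simple_left w b ih => rw [destutteredWord_simple_mul, wordProd_toggleHead, ih]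

end CoxeterSystem

/-- In the universal (free) Coxeter system on `B`, any two destuttered words with the
same product of simple reflections are equal; that is, the elements of the universal
Coxeter group are in bijection with destuttered words via the product map. -/
theorem universal_destuttered_words_injective {B W : Type*} [DecidableEq B] [Group W]
    (cs : CoxeterSystem (universalCoxeterMatrix B) W) :
    (∀ L L' : List B, L.destutter (· ≠ ·) = L → L'.destutter (· ≠ ·) = L' →
      cs.wordProd L = cs.wordProd L' → L = L') ∧
    (∀ w : W, ∃ L : List B, L.destutter (· ≠ ·) = L ∧ cs.wordProd L = w) := by
  refine ⟨fun L L' hL hL' h => ?_, fun w => ⟨(cs.destutteredWord w).1, ?_, ?_⟩⟩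
  · rw [← cs.destutteredWord_wordProd ((List.destutter_eq_self_iff _ L).mp hL), h,
      cs.destutteredWord_wordProd ((List.destutter_eq_self_iff _ L').mp hL')]
  · exact List.destutter_of_isChain _ _ (cs.destutteredWord w).2
  · exact cs.wordProd_destutteredWord w
end

section
/- For every n ≥ 2 and every permutation w ∈ S_n, the sum over all pipe dreams D of size n with shape w (i.e., with Demazure product δ(word(D)) = w) of (−1)^(|D| − ℓ(w)) equals 1. Equivalently, writing PD_k(w) for the set of pipe dreams of shape w with excess k, one has Σ_k (−1)^k |PD_k(w)| = 1. -/
/-- `D` is a pipe dream of size `n`: a finite set of pairs `(i, j)` of positive integers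
with `i + j ≤ n`. -/
def IsPipeDream (n : ℕ) (D : Finset (ℕ × ℕ)) : Prop :=
  ∀ c ∈ D, 1 ≤ c.1 ∧ 1 ≤ c.2 ∧ c.1 + c.2 ≤ n

/-- The word of a pipe dream `D` of size `n`: reading the rows `i = 1, 2, …` from top to
bottom and each row from right to left (`j` decreasing), recording the letter `i + j - 1`
for each cross `(i, j) ∈ D`. -/
def pdWord (n : ℕ) (D : Finset (ℕ × ℕ)) : List ℕ :=
  ((List.range n).map (· + 1)).flatMap (fun i =>
    ((((List.range n).map (· + 1)).reverse.filter (fun j => (i, j) ∈ D)).map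
      (fun j => i + j - 1)))

/-- The simple transposition `s k = (k, k+1)` (1-based) in the symmetric group on
`{1, …, n}`, realized as a permutation of `Fin n`; equals the identity if `k` is out of
range. -/
def simpleT (n k : ℕ) : Equiv.Perm (Fin n) :=
  if h : 0 < k ∧ k < n then
    Equiv.swap ⟨k - 1, lt_of_le_of_lt (Nat.sub_le k 1) h.2⟩ ⟨k, h.2⟩
  else 1

/-- The number of inversions of a permutation of `Fin n` (the Coxeter length in `S_n`). -/
def invCount (n : ℕ) (w : Equiv.Perm (Fin n)) : ℕ :=
  (Finset.univ.filter (fun p : Fin n × Fin n => p.1 < p.2 ∧ w p.2 < w p.1)).card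

/-- The product of the simple transpositions along a word. -/
def pdProd (n : ℕ) (L : List ℕ) : Equiv.Perm (Fin n) :=
  (L.map (simpleT n)).prod

/-- The Demazure product of a word: the left fold starting from the identity whose step
sends `(w, k)` to `w * s k` if this increases the number of inversions, and to `w`
otherwise. -/
def pdDemazure (n : ℕ) (L : List ℕ) : Equiv.Perm (Fin n) :=
  L.foldl (fun w k =>
    if invCount n w < invCount n (w * simpleT n k) then w * simpleT n k else w) 1

/-- All possible cells of a pipe dream of size `n`. -/
def allCells (n : ℕ) : Finset (ℕ × ℕ) :=
  (Finset.range (n + 1) ×ˢ Finset.range (n + 1)).filter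
    (fun c => 1 ≤ c.1 ∧ 1 ≤ c.2 ∧ c.1 + c.2 ≤ n)

/-- The pipe dream `D` admits a slide move in row `i` at its leftmost cross `(i, j)`:
`j ≥ 2`, `(i, j)` is the leftmost cross of row `i`, and every cross `(i+1, j')` of row
`i + 1` satisfies `j' < j`. -/
def AdmitsSlideAt (D : Finset (ℕ × ℕ)) (i j : ℕ) : Prop :=
  (i, j) ∈ D ∧ 2 ≤ j ∧ (∀ j', (i, j') ∈ D → j ≤ j') ∧ (∀ j', (i + 1, j') ∈ D → j' < j)

/-- `D'` is obtained from `D` by a slide move: some leftmost cross `(i, j)` admitting a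
slide move is moved southwest to `(i+1, j-1)`. -/
def SlideMove (D D' : Finset (ℕ × ℕ)) : Prop :=
  ∃ i j, AdmitsSlideAt D i j ∧ D' = insert (i + 1, j - 1) (D.erase (i, j))

/-- `D` is quasi-Yamanouchi: it admits no slide move. -/
def QuasiYamanouchi (D : Finset (ℕ × ℕ)) : Prop :=
  ∀ i j, ¬ AdmitsSlideAt D i j

/-- The adjacent transposition `simpleT n k` written as a swap, for a letter in range. -/
theorem simpleT_eq_swap {n k : ℕ} (h : 0 < k ∧ k < n) :
    simpleT n k = Equiv.swap ⟨k - 1, lt_of_le_of_lt (Nat.sub_le k 1) h.2⟩ ⟨k, h.2⟩ := by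
  simp [simpleT, h]

theorem simpleT_mul_self (n k : ℕ) : simpleT n k * simpleT n k = 1 := by
  unfold simpleT
  split_ifs <;> simp

theorem mul_simpleT_mul_simpleT {n : ℕ} (w : Equiv.Perm (Fin n)) (k : ℕ) :
    w * simpleT n k * simpleT n k = w := by
  rw [mul_assoc, simpleT_mul_self, mul_one]

/-- An adjacent transposition of two increasing values creates exactly one inversion. -/
theorem invCount_mul_swap {n : ℕ} (w : Equiv.Perm (Fin n)) (a b : Fin n)
    (hab : (a : ℕ) + 1 = b) (h : w a < w b) :
    invCount n (w * Equiv.swap a b) = invCount n w + 1 := by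
  have key : Finset.univ.filter (fun p : Fin n × Fin n =>
        p.1 < p.2 ∧ (w * Equiv.swap a b) p.2 < (w * Equiv.swap a b) p.1) =
      insert (a, b) ((Finset.univ.filter
        (fun p : Fin n × Fin n => p.1 < p.2 ∧ w p.2 < w p.1)).map
          ((Equiv.swap a b).prodCongr (Equiv.swap a b)).toEmbedding) := by
    ext ⟨x, y⟩
    simp only [Finset.mem_insert, Finset.mem_map_equiv, Finset.mem_filter, Finset.mem_univ,
      true_and, Equiv.prodCongr_symm, Equiv.symm_swap, Equiv.prodCongr_apply, Prod.map_apply,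
      Prod.mk.injEq]
    rw [Equiv.Perm.mul_apply, Equiv.Perm.mul_apply]
    have hne : a ≠ b := by rintro rfl; omega
    by_cases hxa : x = a
    · subst hxa
      by_cases hyb : y = b
      · subst hyb
        rw [Equiv.swap_apply_left, Equiv.swap_apply_right]
        exact iff_of_true ⟨Fin.lt_def.2 (by omega), h⟩ (Or.inl ⟨rfl, rfl⟩)
      · by_cases hya : y = x
        · subst hya; simp [hyb]
        · rw [Equiv.swap_apply_left, Equiv.swap_apply_of_ne_of_ne hya hyb]
          simp only [Fin.lt_def, Fin.ext_iff] at *; omega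
    · by_cases hxb : x = b
      · subst hxb
        by_cases hya : y = a
        · subst hya
          rw [Equiv.swap_apply_left, Equiv.swap_apply_right]
          simp only [Fin.lt_def, Fin.ext_iff] at *; omega
        · by_cases hyb : y = x
          · subst hyb; simp [hxa]
          · rw [Equiv.swap_apply_right, Equiv.swap_apply_of_ne_of_ne hya hyb]
            simp only [Fin.lt_def, Fin.ext_iff] at *; omega
      · rw [Equiv.swap_apply_of_ne_of_ne hxa hxb]
        by_cases hya : y = a
        · subst hya
          rw [Equiv.swap_apply_left]
          simp only [Fin.lt_def, Fin.ext_iff] at *; omega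
        · by_cases hyb : y = b
          · subst hyb
            rw [Equiv.swap_apply_right]
            simp only [Fin.lt_def, Fin.ext_iff] at *; omega
          · rw [Equiv.swap_apply_of_ne_of_ne hya hyb]
            simp [hxa]
  unfold invCount
  rw [key, Finset.card_insert_of_notMem, Finset.card_map]
  simp only [Finset.mem_map_equiv, Finset.mem_filter, Finset.mem_univ,
      true_and, Equiv.prodCongr_symm, Equiv.symm_swap, Equiv.prodCongr_apply, Prod.map_apply,
      Equiv.swap_apply_left, Equiv.swap_apply_right, Fin.lt_def]
  omega

theorem invCount_mul_simpleT_of_lt {n k : ℕ} (hk : 0 < k ∧ k < n) (w : Equiv.Perm (Fin n))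
    (h : w ⟨k - 1, lt_of_le_of_lt (Nat.sub_le k 1) hk.2⟩ < w ⟨k, hk.2⟩) :
    invCount n (w * simpleT n k) = invCount n w + 1 := by
  rw [simpleT_eq_swap hk]
  exact invCount_mul_swap w _ _ (by simp; omega) h

theorem invCount_mul_simpleT_of_gt {n k : ℕ} (hk : 0 < k ∧ k < n) (w : Equiv.Perm (Fin n))
    (h : w ⟨k, hk.2⟩ < w ⟨k - 1, lt_of_le_of_lt (Nat.sub_le k 1) hk.2⟩) :
    invCount n w = invCount n (w * simpleT n k) + 1 := by
  have := invCount_mul_simpleT_of_lt hk (w * simpleT n k) (by simpa [simpleT_eq_swap hk] using h)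
  rwa [mul_simpleT_mul_simpleT] at this

theorem apply_lt_or_gt {n k : ℕ} (hk : 0 < k ∧ k < n) (w : Equiv.Perm (Fin n)) :
    w ⟨k - 1, lt_of_le_of_lt (Nat.sub_le k 1) hk.2⟩ < w ⟨k, hk.2⟩ ∨
      w ⟨k, hk.2⟩ < w ⟨k - 1, lt_of_le_of_lt (Nat.sub_le k 1) hk.2⟩ := by
  apply lt_or_gt_of_ne
  rw [w.injective.ne_iff, Ne, Fin.mk.injEq]
  omega

theorem invCount_mul_simpleT {n k : ℕ} (hk : 0 < k ∧ k < n) (w : Equiv.Perm (Fin n)) :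
    invCount n (w * simpleT n k) = invCount n w + 1 ∨
      invCount n w = invCount n (w * simpleT n k) + 1 :=
  (apply_lt_or_gt hk w).imp (invCount_mul_simpleT_of_lt hk w) (invCount_mul_simpleT_of_gt hk w)

/-- The step of the Demazure product. -/
def demazureStep (n : ℕ) (w : Equiv.Perm (Fin n)) (k : ℕ) : Equiv.Perm (Fin n) :=
  if invCount n w < invCount n (w * simpleT n k) then w * simpleT n k else w

theorem pdDemazure_append_singleton (n : ℕ) (L : List ℕ) (k : ℕ) :
    pdDemazure n (L ++ [k]) = demazureStep n (pdDemazure n L) k := by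
  rw [pdDemazure, List.foldl_append]
  rfl

/-- The shorter of `w` and `w * s k`: positions `k` and `k + 1` get sorted. -/
def sortStep (n : ℕ) (k : ℕ) (w : Equiv.Perm (Fin n)) : Equiv.Perm (Fin n) :=
  if invCount n w < invCount n (w * simpleT n k) then w else w * simpleT n k

/-- The letter recorded for a cell. -/
def cellLetter (c : ℕ × ℕ) : ℕ := c.1 + c.2 - 1

theorem invCount_one (n : ℕ) : invCount n 1 = 0 := by
  simp only [invCount, Finset.card_eq_zero, Finset.filter_eq_empty_iff]
  rintro ⟨x, y⟩ -
  simp only [Equiv.Perm.one_apply, Fin.lt_def]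
  omega

theorem invCount_pdDemazure_le (n : ℕ) (L : List ℕ) : invCount n (pdDemazure n L) ≤ L.length := by
  induction L using List.reverseRecOn with
  | nil => simp [pdDemazure, invCount_one]
  | append_singleton L k ih =>
    rw [pdDemazure_append_singleton, List.length_append, List.length_singleton, demazureStep]
    split_ifs with h
    · by_cases hk : 0 < k ∧ k < n
      · rcases invCount_mul_simpleT hk (pdDemazure n L) with h' | h' <;> omega
      · simp [simpleT, hk] at h
    · omega

theorem demazureStep_ne_of_lt {n k : ℕ} {w : Equiv.Perm (Fin n)}
    (h : invCount n w < invCount n (w * simpleT n k)) (v : Equiv.Perm (Fin n)) :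
    demazureStep n v k ≠ w := by
  rintro rfl
  unfold demazureStep at h
  split_ifs at h with hv
  · rw [mul_simpleT_mul_simpleT] at h
    omega
  · exact hv h

theorem demazureStep_eq_iff_of_gt {n k : ℕ} {w : Equiv.Perm (Fin n)}
    (h : invCount n (w * simpleT n k) < invCount n w) (v : Equiv.Perm (Fin n)) :
    demazureStep n v k = w ↔ v = w ∨ v = w * simpleT n k := by
  constructor
  · rintro rfl
    unfold demazureStep
    split_ifs with hv
    · simp [mul_simpleT_mul_simpleT]
    · simp
  · rintro (rfl | rfl)
    · exact if_neg h.not_gt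
    · unfold demazureStep
      rw [mul_simpleT_mul_simpleT, if_pos h]

/-- The signed count of the subsets of a list of cells with given Demazure product is `±1` or `0`,
according to whether sorting along the reversed list takes the permutation to the identity. -/
theorem sum_powerset_eq_ite (n : ℕ) (C : List (ℕ × ℕ)) (hC : C.Nodup)
    (hr : ∀ c ∈ C, 0 < cellLetter c ∧ cellLetter c < n) (w : Equiv.Perm (Fin n)) :
    ∑ D ∈ C.toFinset.powerset,
      (if pdDemazure n ((C.filter (· ∈ D)).map cellLetter) = w then (-1 : ℤ) ^ D.card else 0) =
    if C.foldr (fun c => sortStep n (cellLetter c)) w = 1 then (-1) ^ invCount n w else 0 := by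
  induction C using List.reverseRecOn generalizing w with
  | nil =>
    by_cases h : w = 1
    · subst h; simp [pdDemazure, invCount_one]
    · simp [pdDemazure, h, Ne.symm h]
  | append_singleton C c ih =>
    have hcC : c ∉ C := by
      intro h
      exact (List.nodup_append.1 hC).2.2 c h c (by simp) rfl
    have ih' := ih (List.nodup_append.1 hC).1 (fun d hd => hr d (by simp [hd]))
    have hk := hr c (by simp)
    have hins : (C ++ [c]).toFinset = insert c C.toFinset := by
      ext; simp
    have hout : ∀ D ∈ C.toFinset.powerset, (C ++ [c]).filter (· ∈ D) = C.filter (· ∈ D) := by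
      intro D hD
      have : c ∉ D := fun h => hcC (by simpa using Finset.mem_powerset.1 hD h)
      simp [List.filter_append, this]
    have hin : ∀ D ∈ C.toFinset.powerset,
        (C ++ [c]).filter (· ∈ insert c D) = C.filter (· ∈ D) ++ [c] := by
      intro D _
      rw [List.filter_append]
      congr 1
      · apply List.filter_congr
        intro x hx
        have : x ≠ c := by rintro rfl; exact hcC hx
        simp [this]
      · simp
    have hcard : ∀ D ∈ C.toFinset.powerset, (insert c D).card = D.card + 1 := by
      intro D hD
      exact Finset.card_insert_of_notMem fun h => hcC (by simpa using Finset.mem_powerset.1 hD h)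
    have hsplit : ∑ D ∈ (C ++ [c]).toFinset.powerset,
          (if pdDemazure n (((C ++ [c]).filter (· ∈ D)).map cellLetter) = w
            then (-1 : ℤ) ^ D.card else 0) =
        ∑ D ∈ C.toFinset.powerset,
          (if pdDemazure n ((C.filter (· ∈ D)).map cellLetter) = w
            then (-1 : ℤ) ^ D.card else 0) +
        ∑ D ∈ C.toFinset.powerset,
          (if demazureStep n (pdDemazure n ((C.filter (· ∈ D)).map cellLetter)) (cellLetter c) = w
            then (-1 : ℤ) ^ (D.card + 1) else 0) := by
      rw [hins, Finset.sum_powerset_insert (by simpa using hcC)]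
      congr 1
      · exact Finset.sum_congr rfl fun D hD => by rw [hout D hD]
      · refine Finset.sum_congr rfl fun D hD => ?_
        rw [hin D hD, hcard D hD, List.map_append, List.map_singleton,
          pdDemazure_append_singleton]
    rw [hsplit, List.foldr_append, List.foldr_cons, List.foldr_nil]
    rcases invCount_mul_simpleT hk w with h | h
    · have hlt : invCount n w < invCount n (w * simpleT n (cellLetter c)) := by omega
      simp only [demazureStep_ne_of_lt hlt, if_false, Finset.sum_const_zero, add_zero]
      rw [sortStep, if_pos hlt, ih']
    · have hgt : invCount n (w * simpleT n (cellLetter c)) < invCount n w := by omega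
      have hne : w ≠ w * simpleT n (cellLetter c) := fun e => by rw [← e] at hgt; omega
      have hneg := ih' (w * simpleT n (cellLetter c))
      rw [sortStep, if_neg hgt.not_gt, ← Finset.sum_add_distrib]
      trans -(if C.foldr (fun c => sortStep n (cellLetter c)) (w * simpleT n (cellLetter c)) = 1
        then (-1 : ℤ) ^ invCount n (w * simpleT n (cellLetter c)) else 0)
      · rw [← hneg, ← Finset.sum_neg_distrib]
        refine Finset.sum_congr rfl fun D _ => ?_
        simp only [demazureStep_eq_iff_of_gt hgt]
        by_cases h1 : pdDemazure n ((C.filter (· ∈ D)).map cellLetter) = w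
        · simp [h1, hne, pow_succ]
        · simp only [h1, if_false, false_or, zero_add, pow_succ]
          split_ifs <;> simp
      · rw [h, pow_succ]
        split_ifs <;> simp

/-- The cells of row `i` with column at most `m`, from right to left. -/
def rowCells (n i m : ℕ) : List (ℕ × ℕ) :=
  (((List.range m).map (· + 1)).reverse.filter (fun j => i + j ≤ n)).map (fun j => (i, j))

/-- The cells of the first `r` rows in reading order. -/
def readingCells (n r : ℕ) : List (ℕ × ℕ) :=
  ((List.range r).map (· + 1)).flatMap (fun i => rowCells n i n)

theorem mem_rowCells {n i m : ℕ} {c : ℕ × ℕ} :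
    c ∈ rowCells n i m ↔ c.1 = i ∧ 1 ≤ c.2 ∧ c.2 ≤ m ∧ i + c.2 ≤ n := by
  obtain ⟨x, y⟩ := c
  simp only [rowCells, List.mem_map, List.mem_filter, List.mem_reverse, List.mem_range,
    Prod.mk.injEq, decide_eq_true_eq]
  constructor
  · rintro ⟨j, ⟨⟨a, ha, rfl⟩, hj⟩, rfl, rfl⟩
    omega
  · rintro ⟨rfl, h1, h2, h3⟩
    exact ⟨y, ⟨⟨y - 1, by omega, by omega⟩, h3⟩, rfl, rfl⟩

theorem mem_readingCells {n : ℕ} {c : ℕ × ℕ} :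
    c ∈ readingCells n n ↔ 1 ≤ c.1 ∧ 1 ≤ c.2 ∧ c.1 + c.2 ≤ n := by
  simp only [readingCells, List.mem_flatMap, List.mem_map, List.mem_range, mem_rowCells]
  constructor
  · rintro ⟨_, ⟨a, ha, rfl⟩, h⟩
    omega
  · rintro h
    exact ⟨c.1, ⟨c.1 - 1, by omega, by omega⟩, rfl, by omega, by omega, by omega⟩

theorem nodup_readingCells (n : ℕ) : (readingCells n n).Nodup := by
  have hrange : ((List.range n).map (· + 1)).Nodup :=
    List.nodup_range.map (add_left_injective 1)
  refine List.nodup_flatMap.2 ⟨fun i _ => ?_, hrange.imp fun {i i'} hne => ?_⟩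
  · exact ((List.nodup_reverse.2 hrange).filter _).map (fun _ _ h => (Prod.mk.inj h).2)
  · intro c hc hc'
    rw [mem_rowCells] at hc hc'
    omega

theorem toFinset_readingCells (n : ℕ) : (readingCells n n).toFinset = allCells n := by
  ext c
  simp only [List.mem_toFinset, mem_readingCells, allCells, Finset.mem_filter,
    Finset.mem_product, Finset.mem_range]
  omega

theorem pdWord_eq_map_filter {n : ℕ} {D : Finset (ℕ × ℕ)} (hD : D ⊆ allCells n) :
    pdWord n D = ((readingCells n n).filter (· ∈ D)).map cellLetter := by
  simp only [pdWord, readingCells, rowCells, List.filter_flatMap, List.map_flatMap]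
  congr 1
  funext i
  rw [List.filter_map, List.map_map, List.filter_filter]
  congr 1
  apply List.filter_congr
  intro j _
  by_cases h : (i, j) ∈ D
  · have : i + j ≤ n := (Finset.mem_filter.1 (hD h)).2.2.2
    simp [h, this]
  · simp [h]

/-- Sorting along the first `m` cells of row `i + 1` moves the entry at position `i` past
`m` entries of the sorted tail. -/
theorem foldr_rowCells_lt {n i : ℕ} (w : Equiv.Perm (Fin n))
    (hw : ∀ p q : Fin n, i + 1 ≤ p → p < q → w p < w q) (m : ℕ) (p q : Fin n)
    (hp : i ≤ p) (hpm : (p : ℕ) ≠ i + m) (hpq : p < q) :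
    (rowCells n (i + 1) m).foldr (fun c => sortStep n (cellLetter c)) w p <
      (rowCells n (i + 1) m).foldr (fun c => sortStep n (cellLetter c)) w q := by
  induction m generalizing p q with
  | zero => exact hw p q (by omega) hpq
  | succ m ih =>
    by_cases hm : i + 1 + (m + 1) ≤ n
    · have hrow : rowCells n (i + 1) (m + 1) = (i + 1, m + 1) :: rowCells n (i + 1) m := by
        simp [rowCells, List.range_succ, hm]
      rw [hrow, List.foldr_cons]
      generalize (rowCells n (i + 1) m).foldr (fun c => sortStep n (cellLetter c)) w = v at ih ⊢
      have hk : cellLetter (i + 1, m + 1) = i + m + 1 := by simp [cellLetter]; omega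
      have hk' : 0 < i + m + 1 ∧ i + m + 1 < n := by omega
      rw [hk, sortStep]
      set a : Fin n := ⟨i + m + 1 - 1, lt_of_le_of_lt (Nat.sub_le _ 1) hk'.2⟩ with ha
      set b : Fin n := ⟨i + m + 1, hk'.2⟩ with hb
      have hav : (a : ℕ) = i + m := by simp [ha]
      have hbv : (b : ℕ) = i + m + 1 := by simp [hb]
      rcases apply_lt_or_gt hk' v with h | h
      · rw [if_pos (by rw [invCount_mul_simpleT_of_lt hk' v h]; omega)]
        by_cases hpa : p = a
        · subst hpa
          by_cases hqb : q = b
          · rw [hqb]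
            exact h
          · refine lt_trans h (ih _ _ ?_ ?_ ?_) <;>
              simp only [Fin.lt_def, Fin.ext_iff] at * <;> omega
        · exact ih p q hp (fun e => hpa (Fin.ext (e.trans hav.symm))) hpq
      · rw [if_neg (by have := invCount_mul_simpleT_of_gt hk' v h; omega), simpleT_eq_swap hk',
          Equiv.Perm.mul_apply, Equiv.Perm.mul_apply]
        have hpb : p ≠ b := fun e => hpm (by rw [e, hbv]; omega)
        by_cases hpa : p = a
        · subst hpa
          rw [Equiv.swap_apply_left]
          by_cases hqb : q = b
          · rw [hqb, Equiv.swap_apply_right]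
            exact h
          · rw [Equiv.swap_apply_of_ne_of_ne hpq.ne' hqb]
            apply ih <;> simp only [Fin.lt_def, Fin.ext_iff] at * <;> omega
        · rw [Equiv.swap_apply_of_ne_of_ne hpa hpb]
          by_cases hqa : q = a
          · subst hqa
            rw [Equiv.swap_apply_left]
            apply ih <;> simp only [Fin.lt_def, Fin.ext_iff] at * <;> omega
          · by_cases hqb : q = b
            · subst hqb
              rw [Equiv.swap_apply_right]
              apply ih <;> simp only [Fin.lt_def, Fin.ext_iff] at * <;> omega
            · rw [Equiv.swap_apply_of_ne_of_ne hqa hqb]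
              apply ih <;> simp only [Fin.lt_def, Fin.ext_iff] at * <;> omega
    · have hrow : rowCells n (i + 1) (m + 1) = rowCells n (i + 1) m := by
        simp [rowCells, List.range_succ, hm]
      rw [hrow]
      exact ih p q hp (by have := q.2; simp only [Fin.lt_def] at hpq; omega) hpq

/-- Insertion sort along the first `r` rows sorts a permutation whose tail is sorted. -/
theorem strictMono_foldr_readingCells {n : ℕ} (r : ℕ) (w : Equiv.Perm (Fin n))
    (hw : ∀ p q : Fin n, r ≤ p → p < q → w p < w q) :
    StrictMono ⇑((readingCells n r).foldr (fun c => sortStep n (cellLetter c)) w) := by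
  induction r generalizing w with
  | zero => exact fun p q h => hw p q (Nat.zero_le _) h
  | succ r ih =>
    have hrows : readingCells n (r + 1) = readingCells n r ++ rowCells n (r + 1) n := by
      simp [readingCells, List.range_succ]
    rw [hrows, List.foldr_append]
    exact ih _ fun p q hp hpq => foldr_rowCells_lt w hw n p q hp (by have := p.2; omega) hpq

theorem foldr_readingCells_eq_one {n : ℕ} (w : Equiv.Perm (Fin n)) :
    (readingCells n n).foldr (fun c => sortStep n (cellLetter c)) w = 1 := by
  have hmono := strictMono_foldr_readingCells n w fun p q hp _ => absurd p.2 hp.not_gt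
  refine Equiv.ext fun x => congrFun ((hmono.range_inj strictMono_id).1 ?_) x
  rw [(Equiv.surjective _).range_eq, Set.range_id]

/-- For every `n ≥ 2` and every permutation `w ∈ S_n`, the sum over all pipe dreams `D`
of size `n` with shape `w` (Demazure product of the word equal to `w`) of
`(−1)^(|D| − ℓ(w))` equals `1`; equivalently `Σ_k (−1)^k |PD_k(w)| = 1`. -/
theorem pipeDream_alternating_sum (n : ℕ) (hn : 2 ≤ n) (w : Equiv.Perm (Fin n)) :
    ∑ D ∈ (allCells n).powerset.filter (fun D => pdDemazure n (pdWord n D) = w),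
      (-1 : ℤ) ^ (D.card - invCount n w) = 1 := by
  have hsum := sum_powerset_eq_ite n (readingCells n n) (nodup_readingCells n)
    (fun c hc => by rw [mem_readingCells] at hc; simp only [cellLetter]; omega) w
  rw [if_pos (foldr_readingCells_eq_one w), toFinset_readingCells] at hsum
  have hlen : ∀ D ∈ (allCells n).powerset, (pdWord n D).length = D.card := by
    intro D hD
    rw [Finset.mem_powerset] at hD
    rw [pdWord_eq_map_filter hD, List.length_map,
      ← List.toFinset_card_of_nodup ((nodup_readingCells n).filter _), List.toFinset_filter,
      toFinset_readingCells]
    congr 1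
    ext c
    simpa using fun h => hD h
  have hsign : (-1 : ℤ) ^ invCount n w * (-1) ^ invCount n w = 1 := by
    rw [← mul_pow]; simp
  have hsq := congrArg ((-1 : ℤ) ^ invCount n w * ·) hsum
  simp only [hsign, Finset.mul_sum] at hsq
  rw [Finset.sum_filter]
  refine Eq.trans ?_ hsq
  refine Finset.sum_congr rfl fun D hD => ?_
  rw [← pdWord_eq_map_filter (Finset.mem_powerset.1 hD)]
  split_ifs with h
  · have hle : invCount n w ≤ D.card := by
      rw [← hlen D hD, ← h]
      exact invCount_pdDemazure_le n _
    obtain ⟨d, hd⟩ := Nat.exists_eq_add_of_le hle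
    rw [hd, Nat.add_sub_cancel_left, pow_add, ← mul_assoc, hsign, one_mul]
  · simp
end

section
/- Let n ≥ 2, and let P and Q be pipe dreams of size n with Q quasi-Yamanouchi. Then Q can be obtained from P by a finite (possibly empty) sequence of slide moves — that is, (P,Q) lies in the reflexive–transitive closure of the slide-move relation — if and only if (word(P)).destutter = word(Q). (In particular, P lies in the glide orbit dst⁻¹(Q) exactly when the destuttered word of P equals the word of Q.) -/
/-- The order in which the cells of a pipe dream are read: rows from top to bottom, and each
row from right to left. -/
def ReadBefore (c d : ℕ × ℕ) : Prop :=
  c.1 < d.1 ∨ (c.1 = d.1 ∧ d.2 < c.2)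

/-- `L` lists the crosses of `D` in reading order. -/
def IsReading (D : Finset (ℕ × ℕ)) (L : List (ℕ × ℕ)) : Prop :=
  L.Pairwise ReadBefore ∧ ∀ c, c ∈ L ↔ c ∈ D

theorem IsReading.unique {D : Finset (ℕ × ℕ)} {L M : List (ℕ × ℕ)}
    (hL : IsReading D L) (hM : IsReading D M) : L = M := by
  have nodup : ∀ {N : List (ℕ × ℕ)}, N.Pairwise ReadBefore → N.Nodup := by
    intro N hN
    refine hN.imp ?_
    rintro a b hab rfl
    simp [ReadBefore] at hab
  have hperm : L.Perm M :=
    (List.perm_ext_iff_of_nodup (nodup hL.1) (nodup hM.1)).2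
      fun c => (hL.2 c).trans (hM.2 c).symm
  refine hperm.eq_of_pairwise ?_ hL.1 hM.1
  intro a b _ _ hab hba
  unfold ReadBefore at hab hba
  omega

theorem exists_isReading {n : ℕ} {D : Finset (ℕ × ℕ)} (hD : IsPipeDream n D) :
    ∃ L, IsReading D L ∧ pdWord n D = L.map cellLetter := by
  refine ⟨((List.range n).map (· + 1)).flatMap fun i =>
    (((List.range n).map (· + 1)).reverse.filter fun j => (i, j) ∈ D).map fun j => (i, j),
    ⟨?_, ?_⟩, ?_⟩
  · have hrange : ((List.range n).map (· + 1)).Pairwise (· < ·) :=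
      List.pairwise_lt_range.map _ fun a b h => Nat.succ_lt_succ h
    rw [List.pairwise_flatMap]
    refine ⟨fun i _ => ?_, hrange.imp ?_⟩
    · refine ((List.pairwise_reverse.2 hrange).filter _).map _ ?_
      intro a b h
      exact Or.inr ⟨rfl, h⟩
    · intro a b hab x hx y hy
      simp only [List.mem_map] at hx hy
      obtain ⟨_, _, rfl⟩ := hx
      obtain ⟨_, _, rfl⟩ := hy
      exact Or.inl hab
  · rintro ⟨i, j⟩
    simp only [List.mem_flatMap, List.mem_map, List.mem_filter, List.mem_reverse,
      List.mem_range, decide_eq_true_eq, Prod.mk.injEq]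
    constructor
    · rintro ⟨_, _, _, ⟨_, h⟩, rfl, rfl⟩
      exact h
    · intro h
      have := hD _ h
      simp only at this
      exact ⟨i, ⟨i - 1, by omega, by omega⟩, j, ⟨⟨j - 1, by omega, by omega⟩, h⟩, rfl, rfl⟩
  · simp only [pdWord, List.map_flatMap, List.map_map]
    rfl

theorem IsReading.pdWord_eq {n : ℕ} {D : Finset (ℕ × ℕ)} {L : List (ℕ × ℕ)}
    (hL : IsReading D L) (hD : IsPipeDream n D) : pdWord n D = L.map cellLetter := by
  obtain ⟨M, hM, h⟩ := exists_isReading hD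
  rw [h, hL.unique hM]

theorem destutter_append_cons_cons_self (A B : List ℕ) (k : ℕ) :
    (A ++ k :: k :: B).destutter (· ≠ ·) = (A ++ k :: B).destutter (· ≠ ·) := by
  have key : ∀ (A : List ℕ) (b : ℕ), List.destutter' (· ≠ ·) b (A ++ k :: k :: B) =
      List.destutter' (· ≠ ·) b (A ++ k :: B) := by
    intro A
    induction A with
    | nil =>
      intro b
      by_cases hb : b = k <;> simp [List.destutter', hb]
    | cons a A ih =>
      intro b
      simp [List.destutter', ih]
  cases A with
  | nil => simp [List.destutter, List.destutter']
  | cons a A => exact key A a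

theorem SlideMove.isPipeDream {n : ℕ} {D D' : Finset (ℕ × ℕ)} (h : SlideMove D D')
    (hD : IsPipeDream n D) : IsPipeDream n D' := by
  obtain ⟨i, j, ⟨hij, hj, -, -⟩, rfl⟩ := h
  intro c hc
  rcases Finset.mem_insert.1 hc with rfl | hc
  · have := hD _ hij
    simp only at this ⊢
    omega
  · exact hD c (Finset.mem_of_mem_erase hc)

theorem SlideMove.destutter_eq {n : ℕ} {D D' : Finset (ℕ × ℕ)} (h : SlideMove D D')
    (hD : IsPipeDream n D) :
    (pdWord n D).destutter (· ≠ ·) = (pdWord n D').destutter (· ≠ ·) := by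
  have hD' := h.isPipeDream hD
  obtain ⟨i, j, ⟨hij, hj, hleft, hbelow⟩, rfl⟩ := h
  obtain ⟨L, hL, hw⟩ := exists_isReading hD
  obtain ⟨A, B, rfl⟩ := List.append_of_mem ((hL.2 _).2 hij)
  obtain ⟨hpw, hmem⟩ := hL
  obtain ⟨hA, hcB, hAB⟩ := List.pairwise_append.1 hpw
  obtain ⟨hc, hB⟩ := List.pairwise_cons.1 hcB
  have hletter : cellLetter (i + 1, j - 1) = cellLetter (i, j) := by
    simp only [cellLetter]
    omega
  have hAnew : ∀ a ∈ A, ReadBefore a (i + 1, j - 1) := by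
    intro a ha
    have := hAB a ha (i, j) (by simp)
    simp only [ReadBefore] at this ⊢
    omega
  have hBnew : ∀ b ∈ B, b = (i + 1, j - 1) ∨ ReadBefore (i + 1, j - 1) b := by
    rintro ⟨i', j'⟩ hb
    have hbD : (i', j') ∈ D := (hmem _).1 (by simp [hb])
    have hbefore := hc _ hb
    simp only [ReadBefore, Prod.mk.injEq] at hbefore ⊢
    rcases hbefore with hlt | ⟨rfl, hlt⟩
    · by_cases hi : i' = i + 1
      · subst hi
        have := hbelow _ hbD
        omega
      · omega
    · have := hleft _ hbD
      omega
  have hnot : (i, j) ∉ A ∧ (i, j) ∉ B := by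
    constructor
    · intro hmA
      have := hAB _ hmA (i, j) (by simp)
      simp [ReadBefore] at this
    · intro hmB
      have := hc _ hmB
      simp [ReadBefore] at this
  have hmem' : ∀ c, c ∈ A ++ (i + 1, j - 1) :: B ↔
      c ∈ insert (i + 1, j - 1) (D.erase (i, j)) := by
    intro c
    rw [Finset.mem_insert, Finset.mem_erase, ← hmem c]
    simp only [List.mem_append, List.mem_cons]
    constructor
    · rintro (hcA | rfl | hcB)
      · exact Or.inr ⟨fun h => hnot.1 (h ▸ hcA), Or.inl hcA⟩
      · exact Or.inl rfl
      · exact Or.inr ⟨fun h => hnot.2 (h ▸ hcB), Or.inr (Or.inr hcB)⟩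
    · tauto
  by_cases hin : (i + 1, j - 1) ∈ B
  · obtain ⟨b, B, rfl⟩ := List.exists_cons_of_ne_nil (List.ne_nil_of_mem hin)
    have hb : b = (i + 1, j - 1) := by
      rcases hBnew b (by simp) with h | h
      · exact h
      · rcases List.mem_cons.1 hin with h' | h'
        · exact h'.symm
        · have := (List.pairwise_cons.1 hB).1 _ h'
          simp only [ReadBefore] at h this
          omega
    subst hb
    have hread : IsReading (insert (i + 1, j - 1) (D.erase (i, j)))
        (A ++ (i + 1, j - 1) :: B) := by
      refine ⟨List.pairwise_append.2 ⟨hA, hB, fun a ha b hb => hAB a ha b (by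
        simp only [List.mem_cons] at hb ⊢
        tauto)⟩, fun c => ?_⟩
      rw [← hmem' c]
      simp
    rw [hw, hread.pdWord_eq hD']
    simp only [List.map_append, List.map_cons, hletter]
    exact destutter_append_cons_cons_self _ _ _
  · have hread : IsReading (insert (i + 1, j - 1) (D.erase (i, j)))
        (A ++ (i + 1, j - 1) :: B) := by
      refine ⟨List.pairwise_append.2 ⟨hA, List.pairwise_cons.2 ⟨fun b hb => ?_, hB⟩,
        fun a ha b hb => ?_⟩, hmem'⟩
      · exact (hBnew b hb).resolve_left fun h => hin (h ▸ hb)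
      · rcases List.mem_cons.1 hb with rfl | hb
        · exact hAnew a ha
        · exact hAB a ha b (by simp [hb])
    rw [hw, hread.pdWord_eq hD']
    simp only [List.map_append, List.map_cons, hletter]

theorem destutter_eq_of_reflTransGen {n : ℕ} {D D' : Finset (ℕ × ℕ)}
    (h : Relation.ReflTransGen SlideMove D D') (hD : IsPipeDream n D) :
    IsPipeDream n D' ∧
      (pdWord n D).destutter (· ≠ ·) = (pdWord n D').destutter (· ≠ ·) := by
  induction h with
  | refl => exact ⟨hD, rfl⟩
  | tail _ hstep ih => exact ⟨hstep.isPipeDream ih.1, ih.2.trans (hstep.destutter_eq ih.1)⟩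

theorem SlideMove.sum_snd_lt {D D' : Finset (ℕ × ℕ)} (h : SlideMove D D') :
    ∑ c ∈ D', c.2 < ∑ c ∈ D, c.2 := by
  obtain ⟨i, j, ⟨hij, hj, -, -⟩, rfl⟩ := h
  have hsum := Finset.add_sum_erase D (fun c : ℕ × ℕ => c.2) hij
  by_cases hin : (i + 1, j - 1) ∈ D.erase (i, j)
  · rw [Finset.insert_eq_of_mem hin]
    simp only at hsum
    omega
  · rw [Finset.sum_insert hin]
    simp only at hsum ⊢
    omega

theorem exists_reflTransGen_quasiYamanouchi (D : Finset (ℕ × ℕ)) :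
    ∃ E, Relation.ReflTransGen SlideMove D E ∧ QuasiYamanouchi E := by
  induction hm : ∑ c ∈ D, c.2 using Nat.strong_induction_on generalizing D with
  | _ m ih =>
    by_cases hD : QuasiYamanouchi D
    · exact ⟨D, .refl, hD⟩
    · simp only [QuasiYamanouchi, not_forall, not_not] at hD
      obtain ⟨i, j, hij⟩ := hD
      have hstep : SlideMove D (insert (i + 1, j - 1) (D.erase (i, j))) := ⟨i, j, hij, rfl⟩
      obtain ⟨E, hE, hEQ⟩ := ih _ (hm ▸ hstep.sum_snd_lt) _ rfl
      exact ⟨E, hE.head hstep, hEQ⟩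

/-- The relation between consecutive crosses in the reading of a quasi-Yamanouchi pipe
dream: the row of the first one is determined by its letter and by the second cross. -/
def QYStep (c d : ℕ × ℕ) : Prop :=
  (c.1 = d.1 ∧ cellLetter d < cellLetter c) ∨
    (c.1 = min (d.1 - 1) (cellLetter c) ∧ cellLetter c < cellLetter d)

theorem QuasiYamanouchi.isChain {n : ℕ} {D : Finset (ℕ × ℕ)} (hD : IsPipeDream n D)
    (hQY : QuasiYamanouchi D) (L : List (ℕ × ℕ)) (hpw : L.Pairwise ReadBefore)
    (hLD : ∀ c ∈ L, c ∈ D) (hup : ∀ c ∈ L, ∀ d ∈ D, ReadBefore c d → d ∈ L) :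
    L.IsChain QYStep ∧ ∀ c ∈ L.getLast?, c.2 = 1 := by
  induction L with
  | nil => simp
  | cons c L ih =>
    obtain ⟨hc, hL⟩ := List.pairwise_cons.1 hpw
    have hup' : ∀ a ∈ L, ∀ d ∈ D, ReadBefore a d → d ∈ L := by
      intro a ha d hd had
      rcases List.mem_cons.1 (hup a (by simp [ha]) d hd had) with rfl | h
      · have := hc a ha
        simp only [ReadBefore] at had this
        omega
      · exact h
    obtain ⟨ihchain, ihlast⟩ := ih hL (fun a ha => hLD a (by simp [ha])) hup'
    have hafter : ∀ d ∈ D, ReadBefore c d → d ∈ L := by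
      intro d hd hcd
      rcases List.mem_cons.1 (hup c (by simp) d hd hcd) with rfl | h
      · simp [ReadBefore] at hcd
      · exact h
    have hcD : c ∈ D := hLD c (by simp)
    obtain ⟨i, j⟩ := c
    have hcpos := hD _ hcD
    have hQ := hQY i j
    simp only [AdmitsSlideAt, not_and, not_forall, not_lt] at hQ
    cases L with
    | nil =>
      refine ⟨List.isChain_singleton _, ?_⟩
      simp only [List.getLast?_singleton, Option.mem_def, Option.some.injEq]
      rintro _ rfl
      by_contra hj
      obtain ⟨j', hj', -⟩ := hQ hcD (by simp only at hcpos hj; omega) (fun j' hj' => by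
        by_contra hlt
        simpa using hafter (i, j') hj' (Or.inr ⟨rfl, not_le.1 hlt⟩))
      simpa using hafter (i + 1, j') hj' (Or.inl (Nat.lt_succ_self i))
    | cons d L =>
      refine ⟨List.isChain_cons_cons.2 ⟨?_, ihchain⟩, by simpa using ihlast⟩
      have hdD : d ∈ D := hLD d (by simp)
      have hcd := hc d (by simp)
      have hnext : ∀ e ∈ D, ReadBefore (i, j) e → e = d ∨ ReadBefore d e := by
        intro e he hce
        rcases List.mem_cons.1 (hafter e he hce) with rfl | h
        · exact Or.inl rfl
        · exact Or.inr ((List.pairwise_cons.1 hL).1 e h)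
      obtain ⟨i', j'⟩ := d
      have hdpos := hD _ hdD
      simp only [ReadBefore, QYStep, cellLetter, Prod.mk.injEq, Prod.forall] at *
      rcases hcd with hlt | ⟨rfl, hlt⟩
      · right
        by_cases hj : j = 1
        · omega
        · obtain ⟨k, hk, hjk⟩ := hQ hcD (by omega) (fun k hk => by
            by_contra hkj
            have := hnext _ _ hk (by omega)
            omega)
          have := hnext _ _ hk (by omega)
          omega
      · left
        omega

theorem eq_of_isChain_of_map_cellLetter_eq (L M : List (ℕ × ℕ))
    (hL : L.IsChain QYStep) (hM : M.IsChain QYStep)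
    (hL1 : ∀ c ∈ L.getLast?, c.2 = 1) (hM1 : ∀ c ∈ M.getLast?, c.2 = 1)
    (hLpos : ∀ c ∈ L, 1 ≤ c.2) (hMpos : ∀ c ∈ M, 1 ≤ c.2)
    (h : L.map cellLetter = M.map cellLetter) : L = M := by
  induction L generalizing M with
  | nil => simpa using h.symm
  | cons c L ih =>
    cases M with
    | nil => simp at h
    | cons d M =>
      simp only [List.map_cons, List.cons.injEq] at h
      have hc := hLpos c (by simp)
      have hd := hMpos d (by simp)
      cases L with
      | nil =>
        obtain rfl : M = [] := by simpa using h.2.symm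
        have hc1 := hL1 c (by simp)
        have hd1 := hM1 d (by simp)
        simp only [cellLetter] at h
        rw [Prod.ext (by omega : c.1 = d.1) (by omega)]
      | cons c' L =>
        cases M with
        | nil => simp at h
        | cons d' M =>
          obtain ⟨hstepL, hL'⟩ := List.isChain_cons_cons.1 hL
          obtain ⟨hstepM, hM'⟩ := List.isChain_cons_cons.1 hM
          have htail := ih (d' :: M) hL' hM' (by simpa using hL1) (by simpa using hM1)
            (fun a ha => hLpos a (List.mem_cons_of_mem _ ha))
            (fun a ha => hMpos a (List.mem_cons_of_mem _ ha)) h.2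
          obtain ⟨rfl, rfl⟩ := List.cons.inj htail
          have h1 := h.1
          simp only [QYStep, cellLetter] at hstepL hstepM h1
          rw [Prod.ext (by omega : c.1 = d.1) (by omega)]

theorem QuasiYamanouchi.reading_isChain {n : ℕ} {D : Finset (ℕ × ℕ)}
    (hQY : QuasiYamanouchi D) (hD : IsPipeDream n D) {L : List (ℕ × ℕ)}
    (hL : IsReading D L) : L.IsChain QYStep ∧ ∀ c ∈ L.getLast?, c.2 = 1 :=
  hQY.isChain hD L hL.1 (fun c => (hL.2 c).1) fun _ _ d hd _ => (hL.2 d).2 hd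

theorem QuasiYamanouchi.destutter_eq {n : ℕ} {D : Finset (ℕ × ℕ)}
    (hQY : QuasiYamanouchi D) (hD : IsPipeDream n D) :
    (pdWord n D).destutter (· ≠ ·) = pdWord n D := by
  obtain ⟨L, hL, hw⟩ := exists_isReading hD
  rw [hw]
  refine List.destutter_of_isChain _ _ ?_
  rw [List.isChain_map]
  refine (hQY.reading_isChain hD hL).1.imp ?_
  intro c d hcd
  unfold QYStep at hcd
  omega

theorem QuasiYamanouchi.eq_of_pdWord_eq {n : ℕ} {D E : Finset (ℕ × ℕ)}
    (hDQ : QuasiYamanouchi D) (hEQ : QuasiYamanouchi E) (hD : IsPipeDream n D)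
    (hE : IsPipeDream n E) (h : pdWord n D = pdWord n E) : D = E := by
  obtain ⟨L, hL, hLw⟩ := exists_isReading hD
  obtain ⟨M, hM, hMw⟩ := exists_isReading hE
  obtain ⟨hLc, hL1⟩ := hDQ.reading_isChain hD hL
  obtain ⟨hMc, hM1⟩ := hEQ.reading_isChain hE hM
  have hLM : L = M := eq_of_isChain_of_map_cellLetter_eq L M hLc hMc hL1 hM1
    (fun c hc => (hD c ((hL.2 c).1 hc)).2.1) (fun c hc => (hE c ((hM.2 c).1 hc)).2.1)
    (by rw [← hLw, ← hMw, h])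
  ext c
  rw [← hL.2 c, ← hM.2 c, hLM]

/-- Let `P` and `Q` be pipe dreams of size `n ≥ 2` with `Q` quasi-Yamanouchi. Then `Q`
can be obtained from `P` by a finite (possibly empty) sequence of slide moves if and only
if the destutter of the word of `P` equals the word of `Q` (i.e. `P` lies in the glide
orbit of `Q`). -/
theorem glideOrbit_iff_destutter (n : ℕ) (hn : 2 ≤ n) (P Q : Finset (ℕ × ℕ))
    (hP : IsPipeDream n P) (hQ : IsPipeDream n Q) (hQY : QuasiYamanouchi Q) :
    Relation.ReflTransGen SlideMove P Q ↔
      (pdWord n P).destutter (· ≠ ·) = pdWord n Q := by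
  constructor
  · intro h
    rw [(destutter_eq_of_reflTransGen h hP).2, hQY.destutter_eq hQ]
  · intro h
    obtain ⟨E, hPE, hEQ⟩ := exists_reflTransGen_quasiYamanouchi P
    obtain ⟨hE, hword⟩ := destutter_eq_of_reflTransGen hPE hP
    rw [hEQ.destutter_eq hE] at hword
    rwa [← hEQ.eq_of_pdWord_eq hQY hE hQ (hword.symm.trans h)]
end

section
/- If a pipe dream D of size n admits a slide move in row i with result D′, then (word(D′)).destutter = (word(D)).destutter; in particular the shape is preserved: δ(word(D′)) = δ(word(D)). -/
theorem List.map_add_one_range_split {n k : ℕ} (hk : k + 2 ≤ n) :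
    (List.range n).map (· + 1) =
      List.range' 1 k ++ (k + 1) :: (k + 2) :: List.range' (k + 3) (n - (k + 2)) := by
  obtain ⟨m, rfl⟩ := Nat.exists_eq_add_of_le hk
  have e : (List.range (k + 2 + m)).map (· + 1) = List.range' 1 (k + (m + 1 + 1)) := by
    simp only [List.range_eq_range', add_comm _ 1, List.map_add_range']
    congr 1
    omega
  rw [e, ← List.range'_append_1, List.range'_succ, List.range'_succ]
  simp [show 1 + k = k + 1 by omega]

/-- The word of row `i` of a pipe dream. -/
def pdRow (n : ℕ) (D : Finset (ℕ × ℕ)) (i : ℕ) : List ℕ :=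
  (((List.range n).map (· + 1)).reverse.filter (fun j => (i, j) ∈ D)).map (fun j => i + j - 1)

theorem pdRow_congr {n i : ℕ} {D E : Finset (ℕ × ℕ)} (h : ∀ j, (i, j) ∈ D ↔ (i, j) ∈ E) :
    pdRow n D i = pdRow n E i := by
  simp only [pdRow, h]

theorem pdWord_eq_append {n k : ℕ} (D : Finset (ℕ × ℕ)) (hk : k + 2 ≤ n) :
    pdWord n D = (List.range' 1 k).flatMap (pdRow n D) ++ (pdRow n D (k + 1) ++
      pdRow n D (k + 2)) ++ (List.range' (k + 3) (n - (k + 2))).flatMap (pdRow n D) := by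
  change List.flatMap (pdRow n D) _ = _
  rw [List.map_add_one_range_split hk]
  simp

theorem pdRow_eq_append {n k : ℕ} (D : Finset (ℕ × ℕ)) (i : ℕ) (hk : k + 2 ≤ n) :
    pdRow n D i =
      ((List.range' (k + 3) (n - (k + 2))).reverse.filter (fun j => (i, j) ∈ D)).map
        (fun j => i + j - 1) ++
      ((if (i, k + 2) ∈ D then [i + k + 1] else []) ++
        (if (i, k + 1) ∈ D then [i + k] else [])) ++
      ((List.range' 1 k).reverse.filter (fun j => (i, j) ∈ D)).map (fun j => i + j - 1) := by
  rw [pdRow, List.map_add_one_range_split hk]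
  by_cases h₁ : (i, k + 1) ∈ D <;> by_cases h₂ : (i, k + 2) ∈ D <;>
    simp [h₁, h₂, List.filter_append] <;> omega

/-- A slide move either leaves the word unchanged or merges two equal adjacent letters. -/
theorem pdWord_slide {n : ℕ} {D : Finset (ℕ × ℕ)} (hD : IsPipeDream n D) {i j : ℕ}
    (h : AdmitsSlideAt D i j) :
    pdWord n (insert (i + 1, j - 1) (D.erase (i, j))) = pdWord n D ∨
      ∃ X a Y, pdWord n D = X ++ a :: a :: Y ∧
        pdWord n (insert (i + 1, j - 1) (D.erase (i, j))) = X ++ a :: Y := by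
  obtain ⟨hmem, hj, hleft, hnext⟩ := h
  obtain ⟨hi, -, hn⟩ := hD _ hmem
  dsimp only at hi hn
  obtain ⟨b, rfl⟩ := Nat.exists_eq_add_of_le' hj
  obtain ⟨a, rfl⟩ := Nat.exists_eq_add_of_le' hi
  set E := insert (a + 1 + 1, b + 2 - 1) (D.erase (a + 1, b + 2)) with hE
  have memE : ∀ p q, (p, q) ∈ E ↔ (p = a + 2 ∧ q = b + 1) ∨
      (¬ (p = a + 1 ∧ q = b + 2) ∧ (p, q) ∈ D) := by
    simp [hE]
  have hother : ∀ p, p ≠ a + 1 → p ≠ a + 2 → pdRow n E p = pdRow n D p := fun p h₁ h₂ =>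
    pdRow_congr fun q => by simp [memE, h₁, h₂]
  have htop : (List.range' 1 a).flatMap (pdRow n E) = (List.range' 1 a).flatMap (pdRow n D) :=
    List.flatMap_congr fun p hp => hother p (by grind) (by grind)
  have hbot : (List.range' (a + 3) (n - (a + 2))).flatMap (pdRow n E) =
      (List.range' (a + 3) (n - (a + 2))).flatMap (pdRow n D) :=
    List.flatMap_congr fun p hp => hother p (by grind) (by grind)
  obtain ⟨R, hR₁, hR₂⟩ : ∃ R, pdRow n D (a + 1) = R ++ [a + b + 2] ∧ pdRow n E (a + 1) = R := by
    refine ⟨_, ?_, pdRow_eq_append E _ (k := b) (by omega)⟩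
    have h₁ : (a + 1, b + 1) ∉ D := fun h => by have := hleft _ h; omega
    have h₂ : ∀ q ∈ (List.range' 1 b).reverse, (a + 1, q) ∉ D := fun q hq h => by
      have := hleft _ h; grind
    have h₃ : (List.range' (b + 3) (n - (b + 2))).reverse.filter (fun q => (a + 1, q) ∈ E) =
        (List.range' (b + 3) (n - (b + 2))).reverse.filter (fun q => (a + 1, q) ∈ D) :=
      List.filter_congr fun q hq => by
        have : q ≠ b + 2 := by grind
        simp [memE, this]
    have h₄ : (List.range' 1 b).reverse.filter (fun q => (a + 1, q) ∈ D) = [] :=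
      List.filter_eq_nil_iff.2 fun q hq => by simpa using h₂ q hq
    have h₅ : (List.range' 1 b).reverse.filter (fun q => (a + 1, q) ∈ E) = [] :=
      List.filter_eq_nil_iff.2 fun q hq => by simp [memE, h₂ q hq]
    rw [pdRow_eq_append D _ (k := b) (by omega), h₃, h₄, h₅]
    simp [memE, hmem, h₁]
    omega
  obtain ⟨S, hS₁, hS₂⟩ : ∃ S, pdRow n D (a + 2) =
      (if (a + 2, b + 1) ∈ D then [a + b + 2] else []) ++ S ∧
      pdRow n E (a + 2) = (a + b + 2) :: S := by
    refine ⟨((List.range' 1 b).reverse.filter (fun q => (a + 2, q) ∈ D)).map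
      (fun q => a + 2 + q - 1), ?_, ?_⟩
    all_goals
      have h₁ : (a + 2, b + 2) ∉ D := fun h => by have := hnext _ h; omega
      have h₂ : ∀ q ∈ (List.range' (b + 3) (n - (b + 2))).reverse, (a + 2, q) ∉ D :=
        fun q hq h => by have := hnext _ h; grind
    · have h₃ : (List.range' (b + 3) (n - (b + 2))).reverse.filter
          (fun q => (a + 2, q) ∈ D) = [] :=
        List.filter_eq_nil_iff.2 fun q hq => by simpa using h₂ q hq
      rw [pdRow_eq_append D _ (k := b) (by omega), h₃]
      simp [h₁, show a + 2 + b = a + b + 2 by omega]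
    · have h₃ : (List.range' (b + 3) (n - (b + 2))).reverse.filter
          (fun q => (a + 2, q) ∈ E) = [] :=
        List.filter_eq_nil_iff.2 fun q hq => by
          have : q ≠ b + 1 := by grind
          simp [memE, h₂ q hq, this]
      have h₄ : (List.range' 1 b).reverse.filter (fun q => (a + 2, q) ∈ E) =
          (List.range' 1 b).reverse.filter (fun q => (a + 2, q) ∈ D) :=
        List.filter_congr fun q hq => by
          have : q ≠ b + 1 := by grind
          simp [memE, this]
      rw [pdRow_eq_append E _ (k := b) (by omega), h₃, h₄]
      simp [memE, h₁, show a + 2 + b = a + b + 2 by omega]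
  rw [pdWord_eq_append D (k := a) (by omega), pdWord_eq_append E (k := a) (by omega), htop, hbot,
    hR₁, hR₂, hS₁, hS₂]
  by_cases hc : (a + 2, b + 1) ∈ D
  · right
    exact ⟨(List.range' 1 a).flatMap (pdRow n D) ++ R, a + b + 2,
      S ++ (List.range' (a + 3) (n - (a + 2))).flatMap (pdRow n D), by simp [hc], by simp⟩
  · left
    simp [hc]

theorem List.destutter_append_cons_cons_self {α : Type*} [DecidableEq α] (X : List α) (a : α)
    (Y : List α) :
    (X ++ a :: a :: Y).destutter (· ≠ ·) = (X ++ a :: Y).destutter (· ≠ ·) := by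
  have key : ∀ (X : List α) (c : α), (X ++ a :: a :: Y).destutter' (· ≠ ·) c =
      (X ++ a :: Y).destutter' (· ≠ ·) c := by
    intro X
    induction X with
    | nil => intro c; by_cases hc : c = a <;> simp [List.destutter', hc]
    | cons x X ih => intro c; simp [List.destutter', ih]
  cases X with
  | nil => simp [List.destutter, List.destutter']
  | cons x X => exact key X x

theorem pdDemazure_append_cons_cons_self (n : ℕ) (X : List ℕ) (a : ℕ) (Y : List ℕ) :
    pdDemazure n (X ++ a :: a :: Y) = pdDemazure n (X ++ a :: Y) := by
  simp only [pdDemazure, List.foldl_append, List.foldl_cons]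
  congr 1
  generalize List.foldl _ _ X = w
  by_cases hw : invCount n w < invCount n (w * simpleT n a)
  · simp [hw, mul_assoc, simpleT_mul_self, hw.le]
  · simp [hw]

/-- If a pipe dream `D` of size `n` admits a slide move in row `i` with result `D'`, then
the destuttered words of `D'` and `D` coincide; in particular the shape is preserved:
`δ(word(D')) = δ(word(D))`. -/
theorem slideMove_preserves_destutter (n : ℕ) (hn : 2 ≤ n) (D : Finset (ℕ × ℕ))
    (hD : IsPipeDream n D) (i j : ℕ) (h : AdmitsSlideAt D i j) :
    (pdWord n (insert (i + 1, j - 1) (D.erase (i, j)))).destutter (· ≠ ·) =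
      (pdWord n D).destutter (· ≠ ·) ∧
    pdDemazure n (pdWord n (insert (i + 1, j - 1) (D.erase (i, j)))) =
      pdDemazure n (pdWord n D) := by
  rcases pdWord_slide hD h with h | ⟨X, a, Y, h₁, h₂⟩
  · simp [h]
  · rw [h₁, h₂]
    exact ⟨(List.destutter_append_cons_cons_self X a Y).symm,
      (pdDemazure_append_cons_cons_self n X a Y).symm⟩
end

section
/- Let D be a reduced pipe dream of size n that admits a slide move in row i with leftmost cross (i,j), and let D′ = (D ∖ {(i,j)}) ∪ {(i+1,j−1)} be its result. Then (i+1, j−1) ∉ D, word(D′) = word(D), and consequently D′ is again a reduced pipe dream with π(word(D′)) = π(word(D)); in particular slide moves send reduced pipe dreams to reduced pipe dreams of the same shape. -/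
theorem exists_map_succ_range_eq_append (n a : ℕ) (ha : 1 ≤ a) (han : a + 1 ≤ n) :
    ∃ P S : List ℕ, (List.range n).map (· + 1) = P ++ a :: (a + 1) :: S ∧
      (∀ x ∈ P, x < a) ∧ ∀ x ∈ S, a + 1 < x := by
  refine ⟨List.range' 1 (a - 1), List.range' (a + 2) (n - a - 1), ?_, ?_, ?_⟩
  · have h1 : (List.range n).map (· + 1) = List.range' 1 n := by
      rw [List.range'_eq_map_range]
      exact List.map_congr_left fun x _ => Nat.add_comm x 1
    have h2 : n = (a - 1) + ((n - a - 1) + 1 + 1) := by omega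
    rw [h1]
    conv_lhs => rw [h2]
    rw [← List.range'_append_1, List.range'_succ, List.range'_succ]
    have h3 : 1 + (a - 1) = a := by omega
    rw [h3]
  · intro x hx
    rw [List.mem_range'_1] at hx
    omega
  · intro x hx
    rw [List.mem_range'_1] at hx
    omega

theorem invCount_simpleT_mul_le (n k : ℕ) (w : Equiv.Perm (Fin n)) :
    invCount n (simpleT n k * w) ≤ invCount n w + 1 := by
  unfold simpleT
  split_ifs with h
  · have hab : (⟨k, h.2⟩ : Fin n).val =
        (⟨k - 1, lt_of_le_of_lt (Nat.sub_le k 1) h.2⟩ : Fin n).val + 1 := by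
      simp only
      omega
    generalize (⟨k - 1, lt_of_le_of_lt (Nat.sub_le k 1) h.2⟩ : Fin n) = a at hab ⊢
    generalize (⟨k, h.2⟩ : Fin n) = b at hab ⊢
    unfold invCount
    refine (Finset.card_le_card (t := insert (w⁻¹ a, w⁻¹ b) (Finset.univ.filter
      (fun p : Fin n × Fin n => p.1 < p.2 ∧ w p.2 < w p.1))) ?_).trans
      (Finset.card_insert_le _ _)
    rintro ⟨p, q⟩ hpq
    obtain ⟨hlt : p < q, hs⟩ := (Finset.mem_filter.1 hpq).2
    rw [Finset.mem_insert, Finset.mem_filter]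
    simp only [Finset.mem_univ, true_and, Equiv.Perm.mul_apply, Prod.mk.injEq,
      Equiv.Perm.eq_inv_iff_eq, hlt] at hs ⊢
    have hne : w p ≠ w q := fun e => hlt.ne (w.injective e)
    simp only [Equiv.swap_apply_def] at hs
    split_ifs at hs <;> simp only [Fin.ext_iff, Fin.lt_def] at * <;> omega
  · simp

theorem invCount_pdProd_le_length (n : ℕ) (L : List ℕ) :
    invCount n (pdProd n L) ≤ L.length := by
  induction L with
  | nil =>
    simp only [invCount, pdProd, List.map_nil, List.prod_nil, Equiv.Perm.one_apply,
      List.length_nil, Nat.le_zero, Finset.card_eq_zero]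
    exact Finset.filter_eq_empty_iff.2 fun p _ hp => lt_asymm hp.1 hp.2
  | cons k L ih =>
    have := invCount_simpleT_mul_le n k (pdProd n L)
    simp only [pdProd, List.map_cons, List.prod_cons, List.length_cons] at *
    omega

theorem pdProd_append (n : ℕ) (L M : List ℕ) :
    pdProd n (L ++ M) = pdProd n L * pdProd n M := by
  simp [pdProd]

theorem pdProd_append_cons_cons_self (n k : ℕ) (L M : List ℕ) :
    pdProd n (L ++ k :: k :: M) = pdProd n (L ++ M) := by
  rw [pdProd_append, pdProd_append]
  congr 1
  simp only [pdProd, List.map_cons, List.prod_cons, ← mul_assoc, simpleT_mul_self, one_mul]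

theorem length_pdWord_le_card (n : ℕ) (D : Finset (ℕ × ℕ)) :
    (pdWord n D).length ≤ D.card := by
  set R := (List.range n).map (· + 1)
  have hR : R.Nodup := List.nodup_range.map (add_left_injective 1)
  have hlen : (pdWord n D).length =
      ((R.product R.reverse).filter (fun c => c ∈ D)).length := by
    simp only [pdWord, List.product, List.filter_flatMap, List.length_flatMap,
      List.length_map, List.filter_map, R]
    rfl
  have hnd : ((R.product R.reverse).filter (fun c => c ∈ D)).Nodup :=
    (hR.product (List.nodup_reverse.2 hR)).filter _
  rw [hlen, ← List.toFinset_card_of_nodup hnd]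
  refine Finset.card_le_card fun c hc => ?_
  simpa using (List.mem_filter.1 (List.mem_toFinset.1 hc)).2

/-- The portion of `pdWord n D` that is read from row `i`. -/
def rowWord (n : ℕ) (D : Finset (ℕ × ℕ)) (i : ℕ) : List ℕ :=
  (((List.range n).map (· + 1)).reverse.filter (fun j => (i, j) ∈ D)).map
    (fun j => i + j - 1)

theorem rowWord_congr {n : ℕ} {D E : Finset (ℕ × ℕ)} {i : ℕ}
    (h : ∀ j, (i, j) ∈ D ↔ (i, j) ∈ E) : rowWord n D i = rowWord n E i := by
  simp only [rowWord, h]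

/-- If all crosses of row `i` lie weakly right of column `a + 1` and all crosses of row `i + 1`
lie weakly left of column `a`, the two row words together contain the letter `i + a` once for
each of `(i, a + 1)`, `(i + 1, a)` in `D`; the remaining letters come from the other crosses. -/
theorem exists_rowWord_eq_append (n i a : ℕ) (ha : 1 ≤ a) (han : a + 1 ≤ n)
    (D : Finset (ℕ × ℕ)) : ∃ U V : List ℕ, ∀ E : Finset (ℕ × ℕ),
      (∀ c, c ≠ (i, a + 1) → c ≠ (i + 1, a) → (c ∈ E ↔ c ∈ D)) →
      (∀ j, (i, j) ∈ E → a + 1 ≤ j) → (∀ j, (i + 1, j) ∈ E → j ≤ a) →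
      rowWord n E i = U ++ (if (i, a + 1) ∈ E then [i + a] else []) ∧
      rowWord n E (i + 1) = (if (i + 1, a) ∈ E then [i + a] else []) ++ V := by
  obtain ⟨P, S, hPS, hP, hS⟩ := exists_map_succ_range_eq_append n a ha han
  refine ⟨(S.reverse.filter (fun j => (i, j) ∈ D)).map (fun j => i + j - 1),
    (P.reverse.filter (fun j => (i + 1, j) ∈ D)).map (fun j => i + 1 + j - 1),
    fun E hE h1 h2 => ?_⟩
  have hia : (i, a) ∉ E := fun hc => by have := h1 _ hc; omega
  have hia' : (i + 1, a + 1) ∉ E := fun hc => by have := h2 _ hc; omega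
  have hPi : P.reverse.filter (fun j => (i, j) ∈ E) = [] := by
    refine List.filter_eq_nil_iff.2 fun x hx hc => ?_
    have := hP x (List.mem_reverse.1 hx)
    have := h1 x (by simpa using hc)
    omega
  have hSi : S.reverse.filter (fun j => (i + 1, j) ∈ E) = [] := by
    refine List.filter_eq_nil_iff.2 fun x hx hc => ?_
    have := hS x (List.mem_reverse.1 hx)
    have := h2 x (by simpa using hc)
    omega
  have hSE : S.reverse.filter (fun j => (i, j) ∈ E) =
      S.reverse.filter (fun j => (i, j) ∈ D) := by
    refine List.filter_congr fun x hx => ?_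
    have := hS x (List.mem_reverse.1 hx)
    exact decide_eq_decide.2 (hE _ (by simp; omega) (by simp))
  have hPE : P.reverse.filter (fun j => (i + 1, j) ∈ E) =
      P.reverse.filter (fun j => (i + 1, j) ∈ D) := by
    refine List.filter_congr fun x hx => ?_
    have := hP x (List.mem_reverse.1 hx)
    exact decide_eq_decide.2 (hE _ (by simp) (by simp; omega))
  have e2 : i + (a + 1) - 1 = i + a := by omega
  constructor
  · simp only [rowWord, hPS, List.reverse_append, List.reverse_cons, List.filter_append, hPi, hSE]
    split_ifs with hc <;> simp [hc, hia, e2]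
  · simp only [rowWord, hPS, List.reverse_append, List.reverse_cons, List.filter_append, hSi, hPE]
    split_ifs with hc <;> simp [hc, hia']

/-- Let `D` be a reduced pipe dream of size `n` admitting a slide move in row `i` with
leftmost cross `(i, j)`, and let `D' = (D ∖ {(i,j)}) ∪ {(i+1, j−1)}` be its result. Then
`(i+1, j−1) ∉ D`, `word(D') = word(D)`, and consequently `D'` is again a reduced pipe
dream with `π(word(D')) = π(word(D))`. -/
theorem slideMove_of_reduced (n : ℕ) (hn : 2 ≤ n) (D : Finset (ℕ × ℕ))
    (hD : IsPipeDream n D) (hred : invCount n (pdProd n (pdWord n D)) = D.card)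
    (i j : ℕ) (h : AdmitsSlideAt D i j) :
    (i + 1, j - 1) ∉ D ∧
    pdWord n (insert (i + 1, j - 1) (D.erase (i, j))) = pdWord n D ∧
    IsPipeDream n (insert (i + 1, j - 1) (D.erase (i, j))) ∧
    invCount n (pdProd n (pdWord n (insert (i + 1, j - 1) (D.erase (i, j))))) =
      (insert (i + 1, j - 1) (D.erase (i, j))).card ∧
    pdProd n (pdWord n (insert (i + 1, j - 1) (D.erase (i, j)))) =
      pdProd n (pdWord n D) := by
  obtain ⟨hij, hj, hleft, hnext⟩ := h
  obtain ⟨a, rfl⟩ : ∃ a, j = a + 1 := ⟨j - 1, by omega⟩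
  rw [Nat.add_sub_cancel]
  obtain ⟨hi1, -, hijn⟩ := hD _ hij
  simp only at hi1 hijn
  set D' := insert (i + 1, a) (D.erase (i, a + 1)) with hD'
  have hmem : ∀ c, c ∈ D' ↔ c = (i + 1, a) ∨ c ≠ (i, a + 1) ∧ c ∈ D := by simp [hD']
  obtain ⟨P, S, hPS, hP, hS⟩ := exists_map_succ_range_eq_append n i hi1 (by omega)
  have hword : ∀ E, pdWord n E = P.flatMap (rowWord n E) ++
      (rowWord n E i ++ rowWord n E (i + 1)) ++ S.flatMap (rowWord n E) := by
    intro E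
    change ((List.range n).map (· + 1)).flatMap (rowWord n E) = _
    simp [hPS]
  obtain ⟨U, V, hUV⟩ := exists_rowWord_eq_append n i a (by omega) (by omega) D
  obtain ⟨hDi, hDi'⟩ := hUV D (fun _ _ _ => Iff.rfl) hleft
    (fun j' hj' => Nat.le_of_lt_succ (hnext j' hj'))
  rw [if_pos hij] at hDi
  have hnot : (i + 1, a) ∉ D := by
    intro hc
    rw [if_pos hc] at hDi'
    have hw : pdWord n D = (P.flatMap (rowWord n D) ++ U) ++
        (i + a) :: (i + a) :: (V ++ S.flatMap (rowWord n D)) := by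
      rw [hword, hDi, hDi']
      simp
    have hle := length_pdWord_le_card n D
    have hinv := hred
    rw [hw, pdProd_append_cons_cons_self] at hinv
    have hle' := hinv.symm.trans_le (invCount_pdProd_le_length n _)
    rw [hw] at hle
    simp only [List.length_append, List.length_cons] at hle hle'
    omega
  rw [if_neg hnot] at hDi'
  have hweq : pdWord n D' = pdWord n D := by
    obtain ⟨hEi, hEi'⟩ := hUV D' (fun c h1 h2 => by simp [hmem, h1, h2])
      (fun j' hj' => by
        rcases (hmem _).1 hj' with h | h
        · simp at h
        · exact hleft _ h.2)
      (fun j' hj' => by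
        rcases (hmem _).1 hj' with h | h
        · exact (Prod.ext_iff.1 h).2.le
        · exact Nat.le_of_lt_succ (hnext _ h.2))
    rw [if_neg (by simp [hmem])] at hEi
    rw [if_pos (by simp [hmem])] at hEi'
    have hrow : ∀ r, r ≠ i → r ≠ i + 1 → rowWord n D' r = rowWord n D r := fun r h1 h2 =>
      rowWord_congr fun j' => by simp [hmem, h1, h2]
    rw [hword, hword, hDi, hDi', hEi, hEi',
      List.flatMap_congr fun x hx => hrow x (by have := hP x hx; omega) (by have := hP x hx; omega),
      List.flatMap_congr fun x hx => hrow x (by have := hS x hx; omega) (by have := hS x hx; omega)]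
    simp
  have hcard : D'.card = D.card := by
    rw [hD', Finset.card_insert_of_notMem (by simp [hnot]), Finset.card_erase_add_one hij]
  refine ⟨hnot, hweq, fun c hc => ?_, by rw [hweq, hred, hcard], by rw [hweq]⟩
  rcases (hmem c).1 hc with rfl | h
  · exact ⟨by simp, by simp only; omega, by simp only; omega⟩
  · exact hD c h.2
end

section
/- If D is a quasi-Yamanouchi pipe dream of size n, then word(D) is destuttered: no two consecutive letters of word(D) are equal, i.e., (word(D)).destutter = word(D). -/
/-- The part of the word of a pipe dream contributed by row `i`. -/
def pdRowWord (n : ℕ) (D : Finset (ℕ × ℕ)) (i : ℕ) : List ℕ :=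
  (((List.range n).map (· + 1)).reverse.filter (fun j => (i, j) ∈ D)).map (fun j => i + j - 1)

theorem mem_pdRowWord {n : ℕ} {D : Finset (ℕ × ℕ)} (hD : IsPipeDream n D) {i x : ℕ} :
    x ∈ pdRowWord n D i ↔ ∃ j, (i, j) ∈ D ∧ i + j - 1 = x := by
  simp only [pdRowWord, List.mem_map, List.mem_filter, List.mem_reverse, List.mem_range,
    decide_eq_true_eq]
  constructor
  · rintro ⟨j, ⟨-, hj⟩, hx⟩
    exact ⟨j, hj, hx⟩
  · rintro ⟨j, hj, hx⟩
    have h := hD _ hj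
    exact ⟨j, ⟨⟨j - 1, by grind, by grind⟩, hj⟩, hx⟩

theorem pairwise_gt_pdRowWord (n : ℕ) (D : Finset (ℕ × ℕ)) (i : ℕ) :
    (pdRowWord n D i).Pairwise (· > ·) := by
  rw [pdRowWord, List.pairwise_map]
  have h : ((List.range n).map (· + 1)).reverse.Pairwise (fun a b => 1 ≤ b ∧ b < a) := by
    rw [List.pairwise_reverse, List.pairwise_map]
    exact List.pairwise_lt_range.imp (by grind)
  exact (h.filter _).imp (by grind)

theorem le_of_mem_head?_of_pairwise_gt {l : List ℕ} (hl : l.Pairwise (· > ·)) {x y : ℕ}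
    (hx : x ∈ l.head?) (hy : y ∈ l) : y ≤ x := by
  cases l with
  | nil => simp at hy
  | cons a l =>
    obtain rfl : a = x := by simpa using hx
    rcases List.mem_cons.1 hy with rfl | hy
    · exact le_rfl
    · exact (List.rel_of_pairwise_cons hl hy).le

theorem le_of_mem_getLast?_of_pairwise_gt {l : List ℕ} (hl : l.Pairwise (· > ·)) {x y : ℕ}
    (hx : x ∈ l.getLast?) (hy : y ∈ l) : x ≤ y := by
  obtain ⟨l', rfl⟩ := List.getLast?_eq_some_iff.1 hx
  rcases List.mem_append.1 hy with hy | hy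
  · exact ((List.pairwise_append.1 hl).2.2 y hy x (List.mem_singleton_self x)).le
  · exact (List.mem_singleton.1 hy).ge

theorem le_of_mem_flatMap_pdRowWord {n : ℕ} {D : Finset (ℕ × ℕ)} (hD : IsPipeDream n D)
    {s m y : ℕ} (hy : y ∈ (List.range' s m).flatMap (pdRowWord n D)) : s ≤ y := by
  obtain ⟨i, hi, hy⟩ := List.mem_flatMap.1 hy
  obtain ⟨j, hj, rfl⟩ := (mem_pdRowWord hD).1 hy
  have h := hD _ hj
  rw [List.mem_range'_1] at hi
  grind

/-- In a quasi-Yamanouchi pipe dream, the last letter of a row is smaller than the first letter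
of the rows below it. -/
theorem QuasiYamanouchi.getLast?_lt_head? {n : ℕ} {D : Finset (ℕ × ℕ)} (hD : IsPipeDream n D)
    (hQY : QuasiYamanouchi D) {s m x y : ℕ} (hsm : s + m = n)
    (hx : x ∈ (pdRowWord n D s).getLast?)
    (hy : y ∈ ((List.range' (s + 1) m).flatMap (pdRowWord n D)).head?) : x < y := by
  have hsy := le_of_mem_flatMap_pdRowWord hD (List.mem_of_mem_head? hy)
  obtain ⟨j, hj, rfl⟩ := (mem_pdRowWord hD).1 (List.mem_of_mem_getLast? hx)
  have hjD := hD _ hj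
  by_cases hj2 : 2 ≤ j
  · have hmin : ∀ j', (s, j') ∈ D → j ≤ j' := fun j' hj' => by
      have h := le_of_mem_getLast?_of_pairwise_gt (pairwise_gt_pdRowWord n D s) hx
        ((mem_pdRowWord hD).2 ⟨j', hj', rfl⟩)
      have := hD _ hj'
      grind
    obtain ⟨j', hj', hjj'⟩ : ∃ j', (s + 1, j') ∈ D ∧ j ≤ j' := by
      by_contra! h
      exact hQY s j ⟨hj, hj2, hmin, h⟩
    have hmem := (mem_pdRowWord hD).2 ⟨j', hj', rfl⟩
    have hjD' := hD _ hj'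
    obtain ⟨m, rfl⟩ : ∃ k, m = k + 1 := ⟨m - 1, by grind⟩
    rw [List.range'_succ, List.flatMap_cons, List.head?_append_of_ne_nil _
      (List.ne_nil_of_mem hmem)] at hy
    have := le_of_mem_head?_of_pairwise_gt (pairwise_gt_pdRowWord n D _) hy hmem
    grind
  · grind

theorem QuasiYamanouchi.isChain_flatMap_pdRowWord {n : ℕ} {D : Finset (ℕ × ℕ)}
    (hD : IsPipeDream n D) (hQY : QuasiYamanouchi D) (m s : ℕ) (hsm : s + m = n + 1) :
    ((List.range' s m).flatMap (pdRowWord n D)).IsChain (· ≠ ·) := by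
  induction m generalizing s with
  | zero => simp
  | succ m ih =>
    rw [List.range'_succ, List.flatMap_cons, List.isChain_append]
    exact ⟨((pairwise_gt_pdRowWord n D s).imp fun h => ne_of_gt h).isChain,
      ih (s + 1) (by omega),
      fun x hx y hy => (hQY.getLast?_lt_head? hD (by omega) hx hy).ne⟩

/-- If `D` is a quasi-Yamanouchi pipe dream of size `n`, then its word is destuttered:
no two consecutive letters of `word(D)` are equal. -/
theorem quasiYamanouchi_word_destuttered (n : ℕ) (D : Finset (ℕ × ℕ))
    (hD : IsPipeDream n D) (hQY : QuasiYamanouchi D) :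
    (pdWord n D).destutter (· ≠ ·) = pdWord n D := by
  have h : pdWord n D = (List.range' 1 n).flatMap (pdRowWord n D) := by
    rw [List.range'_eq_map_range]
    simp only [Nat.add_comm 1]
    rfl
  rw [h]
  exact List.destutter_of_isChain _ _
    (hQY.isChain_flatMap_pdRowWord hD n 1 (Nat.add_comm 1 n))
end

section
/- Let n ≥ 2 and let S be a destuttered word over {1,…,n−1}. If there exists a pipe dream of size n whose word equals S, then there exists exactly one quasi-Yamanouchi pipe dream Q of size n with word(Q) = S. -/
/-- The reading order on cells: rows from top to bottom, each row from right to left. -/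
def ReadsBefore (c d : ℕ × ℕ) : Prop :=
  c.1 < d.1 ∨ (c.1 = d.1 ∧ d.2 < c.2)

/-- The crosses of a pipe dream of size `n`, listed in reading order. -/
def crossList (n : ℕ) (D : Finset (ℕ × ℕ)) : List (ℕ × ℕ) :=
  ((List.range n).map (· + 1)).flatMap (fun i =>
    (((List.range n).map (· + 1)).reverse.filter (fun j => (i, j) ∈ D)).map
      (fun j => (i, j)))

theorem pdWord_eq_map_crossList (n : ℕ) (D : Finset (ℕ × ℕ)) :
    pdWord n D = (crossList n D).map cellLetter := by
  simp [pdWord, crossList, List.map_flatMap, cellLetter, Function.comp_def]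

theorem mem_crossList {n : ℕ} {D : Finset (ℕ × ℕ)} (hD : IsPipeDream n D) (c : ℕ × ℕ) :
    c ∈ crossList n D ↔ c ∈ D := by
  obtain ⟨i, j⟩ := c
  simp only [crossList, List.mem_flatMap, List.mem_map, List.mem_filter, List.mem_reverse,
    List.mem_range, decide_eq_true_eq, Prod.mk.injEq]
  constructor
  · rintro ⟨_, _, _, ⟨_, h⟩, rfl, rfl⟩
    exact h
  · intro h
    obtain ⟨h₁, h₂, h₃⟩ := hD _ h
    simp only at h₁ h₂ h₃
    exact ⟨i, ⟨i - 1, by omega, by omega⟩, j, ⟨⟨j - 1, by omega, by omega⟩, h⟩, rfl, rfl⟩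

theorem pairwise_crossList (n : ℕ) (D : Finset (ℕ × ℕ)) :
    (crossList n D).Pairwise ReadsBefore := by
  have hlt : ((List.range n).map (· + 1)).Pairwise (· < ·) := by
    rw [List.pairwise_map]
    exact List.pairwise_lt_range.imp (by omega)
  rw [crossList, List.pairwise_flatMap]
  refine ⟨fun i _ => ?_, hlt.imp fun {i i'} hii' => ?_⟩
  · rw [List.pairwise_map]
    refine List.Pairwise.filter _ ?_
    rw [List.pairwise_reverse]
    exact hlt.imp fun h => Or.inr ⟨rfl, h⟩
  · simp only [List.mem_map]
    rintro _ ⟨_, _, rfl⟩ _ ⟨_, _, rfl⟩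
    exact Or.inl hii'

theorem not_readsBefore_self (c : ℕ × ℕ) : ¬ ReadsBefore c c := by
  unfold ReadsBefore
  omega

theorem ReadsBefore.asymm {c d : ℕ × ℕ} (h : ReadsBefore c d) : ¬ ReadsBefore d c := by
  unfold ReadsBefore at *
  omega

theorem eq_crossList {n : ℕ} {D : Finset (ℕ × ℕ)} (hD : IsPipeDream n D)
    {L : List (ℕ × ℕ)} (hL : L.Pairwise ReadsBefore) (hmem : ∀ c, c ∈ L ↔ c ∈ D) :
    L = crossList n D := by
  have nodup {M : List (ℕ × ℕ)} (hM : M.Pairwise ReadsBefore) : M.Nodup :=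
    hM.imp fun {c d} h => by
      rintro rfl
      exact not_readsBefore_self c h
  have hperm : L.Perm (crossList n D) :=
    (List.perm_ext_iff_of_nodup (nodup hL) (nodup (pairwise_crossList n D))).2
      fun c => (hmem c).trans (mem_crossList hD c).symm
  exact hperm.eq_of_pairwise (fun _ _ _ _ h h' => (h.asymm h').elim) hL
    (pairwise_crossList n D)

theorem QuasiYamanouchi.of_toFinset_cons {c : ℕ × ℕ} {L : List (ℕ × ℕ)}
    (hL : (c :: L).Pairwise ReadsBefore) (h : QuasiYamanouchi (c :: L).toFinset) :
    QuasiYamanouchi L.toFinset := by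
  rintro i j ⟨hij, hj, hleft, hbelow⟩
  rw [List.pairwise_cons] at hL
  simp only [List.mem_toFinset] at hij hleft hbelow
  have hc := hL.1 _ hij
  refine h i j ⟨by simp [hij], hj, fun j' hj' => ?_, fun j' hj' => ?_⟩
  · simp only [List.mem_toFinset, List.mem_cons] at hj'
    rcases hj' with rfl | hj'
    · simp only [ReadsBefore] at hc
      omega
    · exact hleft j' hj'
  · simp only [List.mem_toFinset, List.mem_cons] at hj'
    rcases hj' with rfl | hj'
    · simp only [ReadsBefore] at hc
      omega
    · exact hbelow j' hj'

theorem row_le_of_quasiYamanouchi {c c' : ℕ × ℕ} {L : List (ℕ × ℕ)}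
    (hL' : (c' :: L).Pairwise ReadsBefore) (hQ : QuasiYamanouchi (c :: L).toFinset)
    (hpos : 1 ≤ c.2) (hpos' : 1 ≤ c'.2) (hletter : cellLetter c = cellLetter c') :
    c'.1 ≤ c.1 := by
  by_contra! hlt
  obtain ⟨i, j⟩ := c
  obtain ⟨i', j'⟩ := c'
  simp only [cellLetter] at *
  rw [List.pairwise_cons] at hL'
  refine hQ i j ⟨by simp, by omega, fun k hk => ?_, fun k hk => ?_⟩
  · simp only [List.mem_toFinset, List.mem_cons, Prod.mk.injEq, true_and] at hk
    rcases hk with rfl | hk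
    · exact le_rfl
    · have := hL'.1 _ hk
      simp only [ReadsBefore] at this
      omega
  · simp only [List.mem_toFinset, List.mem_cons, Prod.mk.injEq] at hk
    rcases hk with hk | hk
    · omega
    · have := hL'.1 _ hk
      simp only [ReadsBefore] at this
      omega

theorem eq_of_quasiYamanouchi_of_map_cellLetter_eq :
    ∀ {L L' : List (ℕ × ℕ)}, L.Pairwise ReadsBefore → L'.Pairwise ReadsBefore →
      (∀ c ∈ L, 1 ≤ c.2) → (∀ c ∈ L', 1 ≤ c.2) →
      QuasiYamanouchi L.toFinset → QuasiYamanouchi L'.toFinset →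
      L.map cellLetter = L'.map cellLetter → L = L'
  | [], L', _, _, _, _, _, _, h => by simpa [eq_comm] using h
  | c :: L, [], _, _, _, _, _, _, h => by simp at h
  | c :: L, c' :: L', hL, hL', hpos, hpos', hQ, hQ', h => by
    simp only [List.map_cons, List.cons.injEq] at h
    obtain rfl : L = L' := eq_of_quasiYamanouchi_of_map_cellLetter_eq hL.of_cons hL'.of_cons
      (fun d hd => hpos d (List.mem_cons_of_mem _ hd))
      (fun d hd => hpos' d (List.mem_cons_of_mem _ hd))
      (hQ.of_toFinset_cons hL) (hQ'.of_toFinset_cons hL') h.2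
    have hc := hpos c List.mem_cons_self
    have hc' := hpos' c' List.mem_cons_self
    have h₁ := row_le_of_quasiYamanouchi hL' hQ hc hc' h.1
    have h₂ := row_le_of_quasiYamanouchi hL hQ' hc' hc h.1.symm
    have h₃ := h.1
    simp only [cellLetter] at h₃
    rw [Prod.ext (le_antisymm h₂ h₁) (by omega : c.2 = c'.2)]

theorem toFinset_crossList {n : ℕ} {D : Finset (ℕ × ℕ)} (hD : IsPipeDream n D) :
    (crossList n D).toFinset = D := by
  ext c
  rw [List.mem_toFinset, mem_crossList hD]

theorem eq_of_quasiYamanouchi_of_pdWord_eq {n : ℕ} {D D' : Finset (ℕ × ℕ)}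
    (hD : IsPipeDream n D) (hD' : IsPipeDream n D') (hQ : QuasiYamanouchi D)
    (hQ' : QuasiYamanouchi D') (h : pdWord n D = pdWord n D') : D = D' := by
  rw [pdWord_eq_map_crossList, pdWord_eq_map_crossList] at h
  rw [← toFinset_crossList hD, ← toFinset_crossList hD']
  congr 1
  refine eq_of_quasiYamanouchi_of_map_cellLetter_eq (pairwise_crossList n D)
    (pairwise_crossList n D') (fun c hc => (hD c ((mem_crossList hD c).1 hc)).2.1)
    (fun c hc => (hD' c ((mem_crossList hD' c).1 hc)).2.1) ?_ ?_ h
  · rwa [toFinset_crossList hD]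
  · rwa [toFinset_crossList hD']

theorem IsPipeDream.slide {n i j : ℕ} {D : Finset (ℕ × ℕ)} (hD : IsPipeDream n D)
    (h : AdmitsSlideAt D i j) :
    IsPipeDream n (insert (i + 1, j - 1) (D.erase (i, j))) := by
  intro c hc
  rcases Finset.mem_insert.1 hc with rfl | hc
  · have := hD _ h.1
    have := h.2.1
    simp only at *
    omega
  · exact hD c (Finset.mem_of_mem_erase hc)

/-- A slide move on a pipe dream with a destuttered word moves a cross to an empty cell and
preserves the word. -/
theorem slide_of_isChain {n i j : ℕ} {D : Finset (ℕ × ℕ)} (hD : IsPipeDream n D)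
    (hchain : (pdWord n D).IsChain (· ≠ ·)) (h : AdmitsSlideAt D i j) :
    (i + 1, j - 1) ∉ D ∧ pdWord n (insert (i + 1, j - 1) (D.erase (i, j))) = pdWord n D := by
  obtain ⟨hij, hj, hleft, hbelow⟩ := h
  obtain ⟨A, B, hAB⟩ := List.append_of_mem ((mem_crossList hD _).2 hij)
  have hmem (c : ℕ × ℕ) : c ∈ A ++ (i, j) :: B ↔ c ∈ D := by rw [← hAB, mem_crossList hD]
  have hsorted := pairwise_crossList n D
  rw [hAB, List.pairwise_append, List.pairwise_cons] at hsorted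
  obtain ⟨hA, ⟨hijB, hB⟩, hAB'⟩ := hsorted
  have hBrow : ∀ c ∈ B, i + 1 < c.1 ∨ (c.1 = i + 1 ∧ c.2 < j) := by
    rintro ⟨k, l⟩ hc
    have h₁ := hijB _ hc
    have hcD : (k, l) ∈ D := (hmem _).1 (by simp [hc])
    have h₂ : k = i → j ≤ l := by rintro rfl; exact hleft l hcD
    have h₃ : k = i + 1 → l < j := by rintro rfl; exact hbelow l hcD
    simp only [ReadsBefore] at *
    omega
  rw [pdWord_eq_map_crossList, hAB] at hchain
  have hnotB : (i + 1, j - 1) ∉ B := by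
    intro hc
    cases B with
    | nil => simp at hc
    | cons b B =>
      have hne : cellLetter (i, j) ≠ cellLetter b := by
        rw [List.map_append, List.map_cons, List.map_cons] at hchain
        exact (List.isChain_cons_cons.1 (List.isChain_append.1 hchain).2.1).1
      have hb := hBrow b List.mem_cons_self
      rcases List.mem_cons.1 hc with rfl | hc
      · simp only [cellLetter] at hne
        omega
      · have := (List.pairwise_cons.1 hB).1 _ hc
        simp only [ReadsBefore] at this
        omega
  have hnotA : ∀ c ∈ A, c.1 ≤ i := fun c hc => by
    have := hAB' c hc (i, j) List.mem_cons_self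
    simp only [ReadsBefore] at this
    omega
  have hnot : (i + 1, j - 1) ∉ D := by
    rw [← hmem, List.mem_append, List.mem_cons]
    rintro (hc | hc | hc)
    · have := hnotA _ hc
      simp only at this
      omega
    · simp at hc
    · exact hnotB hc
  have hsort' : (A ++ (i + 1, j - 1) :: B).Pairwise ReadsBefore := by
    refine List.pairwise_append.2 ⟨hA, List.pairwise_cons.2 ⟨fun c hc => ?_, hB⟩, ?_⟩
    · have h₁ := hBrow c hc
      have h₂ : ¬ (c.1 = i + 1 ∧ c.2 = j - 1) := fun h => hnotB (by
        rwa [← h.1, ← h.2])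
      simp only [ReadsBefore]
      omega
    · intro a ha b hb
      rcases List.mem_cons.1 hb with rfl | hb
      · exact Or.inl (Nat.lt_succ_of_le (hnotA a ha))
      · exact hAB' a ha b (List.mem_cons_of_mem _ hb)
  refine ⟨hnot, ?_⟩
  have heq := eq_crossList (hD.slide ⟨hij, hj, hleft, hbelow⟩) hsort' fun c => by
    have hnotij : (i, j) ∉ A ∧ (i, j) ∉ B :=
      ⟨fun hc => not_readsBefore_self _ (hAB' _ hc _ List.mem_cons_self),
        fun hc => not_readsBefore_self _ (hijB _ hc)⟩
    rw [Finset.mem_insert, Finset.mem_erase, ← hmem]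
    simp only [List.mem_append, List.mem_cons]
    by_cases hc : c = (i, j)
    · subst hc
      simp [hnotij]
    · tauto
  rw [pdWord_eq_map_crossList, pdWord_eq_map_crossList, ← heq, hAB]
  simp only [List.map_append, List.map_cons, cellLetter]
  rw [show i + 1 + (j - 1) - 1 = i + j - 1 by omega]

theorem sum_row_slide {i j : ℕ} {D : Finset (ℕ × ℕ)} (hij : (i, j) ∈ D)
    (hnot : (i + 1, j - 1) ∉ D) :
    ∑ c ∈ insert (i + 1, j - 1) (D.erase (i, j)), c.1 = ∑ c ∈ D, c.1 + 1 := by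
  rw [Finset.sum_insert fun h => hnot (Finset.mem_of_mem_erase h),
    ← Finset.add_sum_erase D _ hij]
  ring

theorem finite_setOf_isPipeDream (n : ℕ) : {D | IsPipeDream n D}.Finite := by
  refine (allCells n).powerset.finite_toSet.subset fun D hD => ?_
  rw [Finset.mem_coe, Finset.mem_powerset]
  intro c hc
  have := hD c hc
  simp only [allCells, Finset.mem_filter, Finset.mem_product, Finset.mem_range]
  omega

theorem exists_quasiYamanouchi_pdWord_eq {n : ℕ} {D : Finset (ℕ × ℕ)} (hD : IsPipeDream n D)
    (hchain : (pdWord n D).IsChain (· ≠ ·)) :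
    ∃ Q, IsPipeDream n Q ∧ QuasiYamanouchi Q ∧ pdWord n Q = pdWord n D := by
  have hfin : {E | IsPipeDream n E ∧ pdWord n E = pdWord n D}.Finite :=
    (finite_setOf_isPipeDream n).subset fun _ h => h.1
  obtain ⟨Q, ⟨hQ, hword⟩, hmax⟩ :=
    Set.exists_max_image _ (fun E : Finset (ℕ × ℕ) => ∑ c ∈ E, c.1) hfin ⟨D, hD, rfl⟩
  refine ⟨Q, hQ, fun i j h => ?_, hword⟩
  obtain ⟨hnot, hslide⟩ := slide_of_isChain hQ (hword ▸ hchain) h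
  have hle := hmax _ ⟨hQ.slide h, hslide.trans hword⟩
  simp only [sum_row_slide h.1 hnot] at hle
  omega

/-- Let `n ≥ 2` and let `S` be a destuttered word over `{1, …, n−1}`. If some pipe dream
of size `n` has word `S`, then there is exactly one quasi-Yamanouchi pipe dream `Q` of
size `n` with `word(Q) = S`. -/
theorem existsUnique_quasiYamanouchi (n : ℕ) (hn : 2 ≤ n) (S : List ℕ)
    (hdes : S.destutter (· ≠ ·) = S) (hrange : ∀ k ∈ S, 1 ≤ k ∧ k ≤ n - 1)
    (hex : ∃ D : Finset (ℕ × ℕ), IsPipeDream n D ∧ pdWord n D = S) :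
    ∃! Q : Finset (ℕ × ℕ), IsPipeDream n Q ∧ QuasiYamanouchi Q ∧ pdWord n Q = S := by
  obtain ⟨D, hD, rfl⟩ := hex
  obtain ⟨Q, hQ, hQY, hword⟩ :=
    exists_quasiYamanouchi_pdWord_eq hD ((List.destutter_eq_self_iff _ _).1 hdes)
  exact ⟨Q, ⟨hQ, hQY, hword⟩, fun Q' ⟨hQ', hQY', hword'⟩ =>
    eq_of_quasiYamanouchi_of_pdWord_eq hQ' hQ hQY' hQY (hword'.trans hword.symm)⟩
end
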